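/- arXiv:math/0204049 — 6 statements merged into one kernel-verified Lean document; each statement's English description precedes it below -/
import Mathlib

section
/- Let f be a continuous real function on an interval I ⊆ ℝ that is operator convex on I. Then for every natural number n, every n-tuple (x_1, …, x_n) of bounded self-adjoint operators on a complex Hilbert space H with spectra contained in I, and every n-tuple (a_1, …, a_n) of bounded operators on H with Σ_{k=1}^n a_k* a_k = 1, one has f(Σ_{k=1}^n a_k* x_k a_k) ≤ Σ_{k=1}^n a_k* f(x_k) a_k in the Loewner order (Jensen's operator inequality). -/
/-- A continuous real function `f` on an interval `I ⊆ ℝ` is *operator convex on `I`* if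
`f(λx + (1−λ)y) ≤ λ f(x) + (1−λ) f(y)` in the Loewner order, for every `λ ∈ [0,1]` and every
pair of bounded self-adjoint operators `x, y` on an infinite-dimensional complex Hilbert space
with spectra contained in `I`; here `f(x)` is given by the continuous functional calculus. -/
def OperatorConvexOn (f : ℝ → ℝ) (I : Set ℝ) : Prop :=
  ∀ (H : Type) [NormedAddCommGroup H] [InnerProductSpace ℂ H] [CompleteSpace H],
    ¬ FiniteDimensional ℂ H →
      ∀ x y : H →L[ℂ] H, IsSelfAdjoint x → IsSelfAdjoint y →
        spectrum ℝ x ⊆ I → spectrum ℝ y ⊆ I →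
          ∀ t : ℝ, t ∈ Set.Icc (0 : ℝ) 1 →
            cfc f (t • x + (1 - t) • y) ≤ t • cfc f x + (1 - t) • cfc f y

open ContinuousLinearMap
open Polynomial (aeval)
open scoped Polynomial

section

variable {H G : Type*} [NormedAddCommGroup H] [InnerProductSpace ℂ H] [CompleteSpace H]
  [NormedAddCommGroup G] [InnerProductSpace ℂ G] [CompleteSpace G]

theorem spectrum_subset_Icc_iff_algebraMap_le {A : H →L[ℂ] H} (hA : IsSelfAdjoint A) {m M : ℝ} :
    spectrum ℝ A ⊆ Set.Icc m M ↔
      algebraMap ℝ (H →L[ℂ] H) m ≤ A ∧ A ≤ algebraMap ℝ (H →L[ℂ] H) M := by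
  rw [algebraMap_le_iff_le_spectrum hA, le_algebraMap_iff_spectrum_le hA]
  exact ⟨fun h => ⟨fun x hx => (h hx).1, fun x hx => (h hx).2⟩,
    fun h x hx => ⟨h.1 x hx, h.2 x hx⟩⟩

theorem adjoint_conj_mono {A B : G →L[ℂ] G} (h : A ≤ B) (W : H →L[ℂ] G) :
    adjoint W ∘L A ∘L W ≤ adjoint W ∘L B ∘L W := by
  rw [ContinuousLinearMap.le_def] at h ⊢
  simpa [comp_sub, sub_comp] using h.adjoint_conj W

theorem adjoint_comp_algebraMap_comp {W : H →L[ℂ] G} (hW : ∀ h, adjoint W (W h) = h) (m : ℝ) :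
    adjoint W ∘L algebraMap ℝ (G →L[ℂ] G) m ∘L W = algebraMap ℝ (H →L[ℂ] H) m := by
  ext h
  simp [Algebra.algebraMap_eq_smul_one, hW]

theorem spectrum_adjoint_conj_subset {A : G →L[ℂ] G} (hA : IsSelfAdjoint A) {m M : ℝ}
    (hAs : spectrum ℝ A ⊆ Set.Icc m M) {W : H →L[ℂ] G} (hW : ∀ h, adjoint W (W h) = h) :
    spectrum ℝ (adjoint W ∘L A ∘L W) ⊆ Set.Icc m M := by
  rw [spectrum_subset_Icc_iff_algebraMap_le hA] at hAs
  rw [spectrum_subset_Icc_iff_algebraMap_le (hA.adjoint_conj W)]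
  have h1 := adjoint_conj_mono hAs.1 W
  have h2 := adjoint_conj_mono hAs.2 W
  rw [adjoint_comp_algebraMap_comp hW] at h1 h2
  exact ⟨h1, h2⟩

omit [CompleteSpace H] [CompleteSpace G] in
theorem aeval_comp_of_comp_eq {A : G →L[ℂ] G} {B : H →L[ℂ] H} {W : H →L[ℂ] G}
    (h : A ∘L W = W ∘L B) (p : ℝ[X]) : aeval A p ∘L W = W ∘L aeval B p := by
  induction p using Polynomial.induction_on' with
  | add p q hp hq => simp only [map_add, add_comp, comp_add, hp, hq]
  | monomial n c =>
    have hn : ∀ n : ℕ, (A ^ n) ∘L W = W ∘L (B ^ n) := by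
      intro n
      induction n with
      | zero => rfl
      | succ k ih =>
        rw [pow_succ, pow_succ, mul_def, mul_def, comp_assoc, h, ← comp_assoc, ih, comp_assoc]
    rw [Polynomial.aeval_monomial, Polynomial.aeval_monomial, ← Algebra.smul_def, ← Algebra.smul_def, smul_comp, hn,
      comp_smul]

theorem norm_cfc_sub_aeval_le {f : ℝ → ℝ} {m M ε : ℝ} (hf : ContinuousOn f (Set.Icc m M))
    (hε : 0 ≤ ε) {p : ℝ[X]} (hp : ∀ x ∈ Set.Icc m M, |p.eval x - f x| < ε)
    {A : H →L[ℂ] H} (hA : IsSelfAdjoint A) (hAs : spectrum ℝ A ⊆ Set.Icc m M) :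
    ‖cfc f A - aeval A p‖ ≤ ε := by
  rw [← cfc_polynomial p A hA, ← cfc_sub f p.eval A (hf.mono hAs) p.continuousOn]
  refine norm_cfc_le hε fun x hx => ?_
  rw [Real.norm_eq_abs, abs_sub_comm]
  exact (hp x (hAs hx)).le

/-- The continuous functional calculus respects intertwining operators. -/
theorem cfc_comp_of_comp_eq {f : ℝ → ℝ} {m M : ℝ} (hf : ContinuousOn f (Set.Icc m M))
    {A : G →L[ℂ] G} {B : H →L[ℂ] H} (hA : IsSelfAdjoint A) (hB : IsSelfAdjoint B)
    (hAs : spectrum ℝ A ⊆ Set.Icc m M) (hBs : spectrum ℝ B ⊆ Set.Icc m M) {W : H →L[ℂ] G}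
    (h : A ∘L W = W ∘L B) : cfc f A ∘L W = W ∘L cfc f B := by
  rw [← sub_eq_zero, ← norm_le_zero_iff]
  refine le_of_forall_pos_le_add fun δ hδ => ?_
  set ε := δ / (2 * (‖W‖ + 1)) with hε
  have hε0 : 0 < ε := by positivity
  obtain ⟨p, hp⟩ := exists_polynomial_near_of_continuousOn m M f hf ε hε0
  have hεW : 2 * (ε * (‖W‖ + 1)) = δ := by rw [hε]; field_simp
  have hdecomp : cfc f A ∘L W - W ∘L cfc f B =
      (cfc f A - aeval A p) ∘L W - W ∘L (cfc f B - aeval B p) := by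
    rw [sub_comp, comp_sub, aeval_comp_of_comp_eq h p]
    abel
  rw [hdecomp]
  have h1 : ‖(cfc f A - aeval A p) ∘L W‖ ≤ ε * ‖W‖ := (opNorm_comp_le _ _).trans <|
    mul_le_mul_of_nonneg_right (norm_cfc_sub_aeval_le hf hε0.le hp hA hAs) (norm_nonneg _)
  have h2 : ‖W ∘L (cfc f B - aeval B p)‖ ≤ ‖W‖ * ε := (opNorm_comp_le _ _).trans <|
    mul_le_mul_of_nonneg_left (norm_cfc_sub_aeval_le hf hε0.le hp hB hBs) (norm_nonneg _)
  have := norm_sub_le ((cfc f A - aeval A p) ∘L W) (W ∘L (cfc f B - aeval B p))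
  linarith

/-- Jensen's operator inequality for the compression by an isometry `V`, obtained by averaging
`X` with its conjugate by the reflection `2 V V* - 1`. -/
theorem cfc_adjoint_conj_le {f : ℝ → ℝ} {I : Set ℝ} {m M : ℝ} (hmM : Set.Icc m M ⊆ I)
    (hf : ContinuousOn f I) {G : Type} [NormedAddCommGroup G] [InnerProductSpace ℂ G]
    [CompleteSpace G] (hG : ¬ FiniteDimensional ℂ G) (hconv : OperatorConvexOn f I)
    {X : G →L[ℂ] G} (hX : IsSelfAdjoint X) (hXs : spectrum ℝ X ⊆ Set.Icc m M)
    {V : H →L[ℂ] G} (hV : ∀ h, adjoint V (V h) = h) :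
    cfc f (adjoint V ∘L X ∘L V) ≤ adjoint V ∘L cfc f X ∘L V := by
  have hfm := hf.mono hmM
  set S : G →L[ℂ] G := (2 : ℝ) • (V ∘L adjoint V) - 1 with hS
  have hSV : ∀ h, S (V h) = V h := fun h => by simp [hS, hV, two_smul]
  have hVS : ∀ g, adjoint V (S g) = adjoint V g := fun g => by simp [hS, hV, two_smul]
  have hS' : adjoint S = S := by
    have hP : IsSelfAdjoint (V ∘L adjoint V) := by
      rw [isSelfAdjoint_iff', adjoint_comp, adjoint_adjoint]
    exact (((IsSelfAdjoint.all (2 : ℝ)).smul hP).sub (.one _)).adjoint_eq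
  have hSS : ∀ g, S (S g) = g := by
    intro g
    nth_rw 1 [hS]
    simp [hVS]
    simp [hS]
  have hS1 : ∀ g, adjoint S (S g) = g := by rwa [hS']
  set Z := adjoint S ∘L X ∘L S with hZ
  have hZsa : IsSelfAdjoint Z := hX.adjoint_conj S
  have hZs : spectrum ℝ Z ⊆ Set.Icc m M := spectrum_adjoint_conj_subset hX hXs hS1
  have hfZ : cfc f Z ∘L S = S ∘L cfc f X :=
    cfc_comp_of_comp_eq hfm hZsa hX hZs hXs (by ext g; simp [hZ, hSS, hS'])
  have hhalf := hconv G hG X Z hX hZsa (hXs.trans hmM) (hZs.trans hmM) (1 / 2) (by norm_num)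
  set Y := (1 / 2 : ℝ) • X + (1 - 1 / 2 : ℝ) • Z with hY
  have hYsa : IsSelfAdjoint Y :=
    ((IsSelfAdjoint.all _).smul hX).add ((IsSelfAdjoint.all _).smul hZsa)
  have hYs : spectrum ℝ Y ⊆ Set.Icc m M := by
    rw [spectrum_subset_Icc_iff_algebraMap_le ‹_›] at hXs hZs ⊢
    have hcomb : ∀ c : ℝ, algebraMap ℝ (G →L[ℂ] G) c =
        (1 / 2 : ℝ) • algebraMap ℝ (G →L[ℂ] G) c +
          (1 - 1 / 2 : ℝ) • algebraMap ℝ (G →L[ℂ] G) c := fun c => by module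
    rw [hcomb m, hcomb M]
    exact ⟨add_le_add (smul_le_smul_of_nonneg_left hXs.1 (by norm_num))
        (smul_le_smul_of_nonneg_left hZs.1 (by norm_num)),
      add_le_add (smul_le_smul_of_nonneg_left hXs.2 (by norm_num))
        (smul_le_smul_of_nonneg_left hZs.2 (by norm_num))⟩
  have hYV : Y ∘L V = V ∘L (adjoint V ∘L X ∘L V) := by
    ext h
    simp only [hY, hZ, hS', hSV, comp_apply, add_apply, smul_apply]
    simp only [hS, sub_apply, smul_apply, comp_apply, one_apply_eq_self]
    module
  have hfY : cfc f Y ∘L V = V ∘L cfc f (adjoint V ∘L X ∘L V) :=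
    cfc_comp_of_comp_eq hfm hYsa (hX.adjoint_conj V) hYs (spectrum_adjoint_conj_subset hX hXs hV)
      hYV
  have hle := adjoint_conj_mono hhalf V
  convert hle using 1
  · rw [hfY]
    ext h
    simp [hV]
  · ext h
    have : cfc f Z (V h) = S (cfc f X (V h)) := by
      simpa [hSV] using DFunLike.congr_fun hfZ (V h)
    simp only [comp_apply, add_apply, smul_apply, this, map_add, hVS,
      (adjoint V).map_smul_of_tower]
    module

variable {ι : Type*} [Fintype ι] [DecidableEq ι]

theorem exists_isSelfAdjoint_diagonal {W : ι → H →L[ℂ] G}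
    (hW : ∀ j k h, adjoint (W j) (W k h) = if j = k then h else 0)
    {x : ι → H →L[ℂ] H} (hx : ∀ k, IsSelfAdjoint (x k)) {m M : ℝ} (hmM : m ≤ M)
    (hxs : ∀ k, spectrum ℝ (x k) ⊆ Set.Icc m M) :
    ∃ X : G →L[ℂ] G, IsSelfAdjoint X ∧ spectrum ℝ X ⊆ Set.Icc m M ∧
      ∀ k, X ∘L W k = W k ∘L x k := by
  set Q : G →L[ℂ] G := 1 - ∑ k, W k ∘L adjoint (W k) with hQ
  have hWW : ∀ k, IsSelfAdjoint (W k ∘L adjoint (W k)) := fun k => by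
    rw [isSelfAdjoint_iff', adjoint_comp, adjoint_adjoint]
  have hQsa : IsSelfAdjoint Q := .sub (.one _) (isSelfAdjoint_sum _ fun k _ => hWW k)
  have hQW : ∀ k h, Q (W k h) = 0 := fun k h => by
    simp [hQ, hW, sum_apply, apply_ite]
  have hQQ : Q * Q = Q := by
    ext g
    rw [mul_apply_eq_comp]
    conv_lhs => enter [2]; rw [hQ]
    simp [map_sum, hQW, sum_apply]
  have hQ0 : 0 ≤ Q := IsStarProjection.nonneg ⟨hQQ, hQsa⟩
  have hconj : ∀ {A B : H →L[ℂ] H}, A ≤ B → ∀ k,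
      W k ∘L A ∘L adjoint (W k) ≤ W k ∘L B ∘L adjoint (W k) := fun h k => by
    simpa using adjoint_conj_mono h (adjoint (W k))
  have hscalar : ∀ c : ℝ, algebraMap ℝ (G →L[ℂ] G) c =
      ∑ k, W k ∘L algebraMap ℝ (H →L[ℂ] H) c ∘L adjoint (W k) + c • Q := fun c => by
    ext g
    simp [hQ, Algebra.algebraMap_eq_smul_one, sum_apply, smul_sub, Finset.smul_sum]
  have hXsa : IsSelfAdjoint (∑ k, W k ∘L x k ∘L adjoint (W k) + m • Q) := by
    refine .add (isSelfAdjoint_sum _ fun k _ => ?_) ((IsSelfAdjoint.all m).smul hQsa)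
    exact (hx k).conj_adjoint (W k)
  refine ⟨∑ k, W k ∘L x k ∘L adjoint (W k) + m • Q, hXsa, ?_, fun k => ?_⟩
  · rw [spectrum_subset_Icc_iff_algebraMap_le hXsa, hscalar m, hscalar M]
    have hxs' := fun k => (spectrum_subset_Icc_iff_algebraMap_le (hx k)).1 (hxs k)
    exact ⟨add_le_add_left (Finset.sum_le_sum fun k _ => hconj (hxs' k).1 k) _,
      add_le_add (Finset.sum_le_sum fun k _ => hconj (hxs' k).2 k)
        (smul_le_smul_of_nonneg_right hmM hQ0)⟩
  · ext h
    simp [hW, hQW, sum_apply, apply_ite]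

theorem cfc_sum_conj_le {f : ℝ → ℝ} {I : Set ℝ} {m M : ℝ} (hmM : m ≤ M)
    (hmMI : Set.Icc m M ⊆ I) (hf : ContinuousOn f I) {G : Type} [NormedAddCommGroup G]
    [InnerProductSpace ℂ G] [CompleteSpace G] (hG : ¬ FiniteDimensional ℂ G)
    (hconv : OperatorConvexOn f I) {W : ι → H →L[ℂ] G}
    (hW : ∀ j k h, adjoint (W j) (W k h) = if j = k then h else 0)
    {x a : ι → H →L[ℂ] H} (hx : ∀ k, IsSelfAdjoint (x k))
    (hxs : ∀ k, spectrum ℝ (x k) ⊆ Set.Icc m M) (ha : ∑ k, star (a k) * a k = 1) :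
    cfc f (∑ k, star (a k) * x k * a k) ≤ ∑ k, star (a k) * cfc f (x k) * a k := by
  obtain ⟨X, hX, hXs, hXW⟩ := exists_isSelfAdjoint_diagonal hW hx hmM hxs
  set V : H →L[ℂ] G := ∑ k, W k ∘L a k with hV
  have hV' : adjoint V = ∑ k, adjoint (a k) ∘L adjoint (W k) := by
    simp [hV, map_sum, adjoint_comp]
  have hconj : ∀ {A : G →L[ℂ] G} {y : ι → H →L[ℂ] H}, (∀ k, A ∘L W k = W k ∘L y k) →
      adjoint V ∘L A ∘L V = ∑ k, star (a k) * y k * a k := fun {A y} hA => by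
    have hA' : ∀ k h, A (W k h) = W k (y k h) := fun k h => DFunLike.congr_fun (hA k) h
    ext h
    rw [hV']
    simp [hV, sum_apply, map_sum, hA', hW, star_eq_adjoint, apply_ite]
  have hVV : ∀ h, adjoint V (V h) = h := fun h => by
    have := DFunLike.congr_fun (hconj (A := 1) (y := fun _ => 1) fun k => rfl) h
    simpa [ha] using this
  have hfX : ∀ k, cfc f X ∘L W k = W k ∘L cfc f (x k) := fun k =>
    cfc_comp_of_comp_eq (hf.mono hmMI) hX (hx k) hXs (hxs k) (hXW k)
  simpa only [hconj hXW, hconj hfX] using cfc_adjoint_conj_le hmMI hf hG hconv hX hXs hVV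

theorem adjoint_lp_single_apply_single {κ : Type*} [DecidableEq κ] (j k : κ) (h : H) :
    adjoint (lp.singleContinuousLinearMap ℂ (fun _ : κ => H) 2 j)
      (lp.singleContinuousLinearMap ℂ (fun _ : κ => H) 2 k h) = if j = k then h else 0 := by
  refine ext_inner_left ℂ fun v => ?_
  rw [adjoint_inner_right]
  simp only [lp.singleContinuousLinearMap_apply, lp.inner_single_left, lp.single_apply,
    Pi.single_apply]

omit [CompleteSpace H] in
theorem not_finiteDimensional_lp (κ : Type*) [Infinite κ] [Nontrivial H] :
    ¬ FiniteDimensional ℂ (lp (fun _ : κ => H) 2) := by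
  classical
  intro hfin
  obtain ⟨v, hv⟩ := exists_ne (0 : H)
  have hli : LinearIndependent ℂ fun k : κ => lp.single (E := fun _ : κ => H) 2 k v := by
    refine linearIndependent_of_ne_zero_of_inner_eq_zero (fun k hk => hv ?_) fun j k hjk => ?_
    · simpa using congr_arg (fun g : lp (fun _ : κ => H) 2 => g k) hk
    · simp [lp.inner_single_left, hjk]
  exact not_finite_iff_infinite.2 ‹Infinite κ› hli.finite

end

/-- **Jensen's operator inequality.** If `f` is a continuous function on an interval `I ⊆ ℝ`
which is operator convex on `I`, then for every `n`-tuple `(x₁, …, xₙ)` of bounded self-adjoint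
operators on a complex Hilbert space `H` with spectra in `I` and every `n`-tuple `(a₁, …, aₙ)`
of bounded operators on `H` with `∑ aₖ* aₖ = 1`, one has
`f(∑ aₖ* xₖ aₖ) ≤ ∑ aₖ* f(xₖ) aₖ` in the Loewner order. -/
theorem jensen_operator_inequality
    (f : ℝ → ℝ) (I : Set ℝ) (hI : I.OrdConnected) (hf : ContinuousOn f I)
    (hconv : OperatorConvexOn f I)
    (H : Type) [NormedAddCommGroup H] [InnerProductSpace ℂ H] [CompleteSpace H]
    (n : ℕ) (x a : Fin n → H →L[ℂ] H)
    (hx : ∀ k, IsSelfAdjoint (x k)) (hxI : ∀ k, spectrum ℝ (x k) ⊆ I)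
    (ha : ∑ k, star (a k) * a k = 1) :
    cfc f (∑ k, star (a k) * x k * a k) ≤ ∑ k, star (a k) * cfc f (x k) * a k := by
  rcases subsingleton_or_nontrivial H with hH | hH
  · exact (Subsingleton.elim _ _).le
  have hne : Nonempty (Fin n) := by
    by_contra hn
    rw [not_nonempty_iff] at hn
    simp at ha
  obtain ⟨m, M, hmM, hmMI, hxs⟩ : ∃ m M : ℝ, m ≤ M ∧ Set.Icc m M ⊆ I ∧
      ∀ k, spectrum ℝ (x k) ⊆ Set.Icc m M := by
    have hK : IsCompact (⋃ k, spectrum ℝ (x k)) :=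
      isCompact_iUnion fun k => spectrum.isCompact (x k)
    have hKI : ⋃ k, spectrum ℝ (x k) ⊆ I := Set.iUnion_subset hxI
    have hKne : (⋃ k, spectrum ℝ (x k)).Nonempty := by
      obtain ⟨k⟩ := hne
      obtain ⟨c, hc⟩ := ContinuousFunctionalCalculus.spectrum_nonempty (R := ℝ) (x k) (hx k)
      exact ⟨c, Set.mem_iUnion.2 ⟨k, hc⟩⟩
    obtain ⟨m, hm⟩ := hK.exists_isLeast hKne
    obtain ⟨M, hM⟩ := hK.exists_isGreatest hKne
    exact ⟨m, M, hm.2 hM.1, hI.out (hKI hm.1) (hKI hM.1), fun k c hc =>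
      ⟨hm.2 (Set.mem_iUnion.2 ⟨k, hc⟩), hM.2 (Set.mem_iUnion.2 ⟨k, hc⟩)⟩⟩
  refine cfc_sum_conj_le hmM hmMI hf (not_finiteDimensional_lp (H := H) ℕ) hconv
    (W := fun k : Fin n => lp.singleContinuousLinearMap ℂ (fun _ : ℕ => H) 2 k)
    (fun j k h => ?_) hx hxs ha
  simp only [adjoint_lp_single_apply_single, Fin.val_inj]
end

section
/- Let f be a continuous real function on an interval I ⊆ ℝ that is operator convex on I. Then f(v* x v) ≤ v* f(x) v for every isometry v (i.e., v* v = 1) on a complex Hilbert space H and every bounded self-adjoint operator x on H with spectrum contained in I. -/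
open ContinuousLinearMap

lemma cfc_starAlgHom_prod {A B : Type*} [CStarAlgebra A] [CStarAlgebra B]
    (φ : A × A →⋆ₐ[ℂ] B) (hφ : Continuous φ) (f : ℝ → ℝ) (a d : A) (ha : IsSelfAdjoint a)
    (hd : IsSelfAdjoint d) (hf : ContinuousOn f (spectrum ℝ a ∪ spectrum ℝ d)) :
    cfc f (φ (a, d)) = φ (cfc f a, cfc f d) := by
  have : ContinuousFunctionalCalculus ℝ (A × A) IsSelfAdjoint :=
    IsSelfAdjoint.instContinuousFunctionalCalculus (A := A × A)
  have had : IsSelfAdjoint (a, d) := Prod.ext ha hd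
  rw [← cfc_map_prod (S := ℂ) f a d hf had ha hd]
  exact (φ.map_cfc f (a, d) (by rwa [Prod.spectrum_eq]) hφ had (had.map φ)).symm

section Orthogonal

variable {H K : Type*} [NormedAddCommGroup H] [InnerProductSpace ℂ H] [CompleteSpace H]
  [NormedAddCommGroup K] [InnerProductSpace ℂ K] [CompleteSpace K]

/-- A pair of isometries `i j : H → K` with orthogonal ranges spanning `K`, exhibiting `K` as the
Hilbert space direct sum `H ⊕ H`. -/
structure IsOrthogonalDecomposition (i j : H →L[ℂ] K) : Prop where
  adjoint_left_left : ∀ h, adjoint i (i h) = h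
  adjoint_right_right : ∀ h, adjoint j (j h) = h
  adjoint_left_right : ∀ h, adjoint i (j h) = 0
  adjoint_right_left : ∀ h, adjoint j (i h) = 0
  add_eq : ∀ k, i (adjoint i k) + j (adjoint j k) = k

/-- The operator on `K ≃ H ⊕ H` with block matrix `[[a, b], [c, d]]`. -/
noncomputable def blockOperator (i j : H →L[ℂ] K) (a b c d : H →L[ℂ] H) : K →L[ℂ] K :=
  i ∘L a ∘L adjoint i + i ∘L b ∘L adjoint j + j ∘L c ∘L adjoint i + j ∘L d ∘L adjoint j

lemma star_blockOperator (i j : H →L[ℂ] K) (a b c d : H →L[ℂ] H) :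
    star (blockOperator i j a b c d) = blockOperator i j (star a) (star c) (star b) (star d) := by
  simp only [blockOperator, star_eq_adjoint, map_add, adjoint_comp, adjoint_adjoint,
    ContinuousLinearMap.comp_assoc]
  abel

namespace IsOrthogonalDecomposition

variable {i j : H →L[ℂ] K} (hij : IsOrthogonalDecomposition i j)
include hij

lemma blockOperator_mul (a b c d a' b' c' d' : H →L[ℂ] H) :
    blockOperator i j a b c d * blockOperator i j a' b' c' d' =
      blockOperator i j (a * a' + b * c') (a * b' + b * d')
        (c * a' + d * c') (c * b' + d * d') := by
  ext k
  simp only [blockOperator, ContinuousLinearMap.mul_def, add_apply, comp_apply, map_add, hij.adjoint_left_left,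
    hij.adjoint_right_right, hij.adjoint_left_right, hij.adjoint_right_left, map_zero]
  abel

lemma blockOperator_one : blockOperator i j 1 0 0 1 = 1 := by
  ext k
  simp [blockOperator, hij.add_eq]

lemma adjoint_comp_blockOperator_comp (a b c d : H →L[ℂ] H) :
    adjoint i ∘L blockOperator i j a b c d ∘L i = a := by
  ext h
  simp [blockOperator, hij.adjoint_left_left, hij.adjoint_left_right, hij.adjoint_right_left]

/-- The block diagonal embedding, as a star algebra homomorphism. -/
noncomputable def diagonal :
    (H →L[ℂ] H) × (H →L[ℂ] H) →⋆ₐ[ℂ] (K →L[ℂ] K) where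
  toFun z := blockOperator i j z.1 0 0 z.2
  map_one' := hij.blockOperator_one
  map_mul' z w := by simp [hij.blockOperator_mul]
  map_zero' := by simp [blockOperator]
  map_add' z w := by
    ext k
    simp only [blockOperator, add_apply, comp_apply, zero_apply, map_add, Prod.fst_add,
      Prod.snd_add, map_zero]
    abel
  commutes' r := by
    ext k
    simp [blockOperator, Algebra.algebraMap_eq_smul_one, ← smul_add, hij.add_eq]
  map_star' z := by simp [star_blockOperator]

lemma diagonal_apply (a d : H →L[ℂ] H) :
    hij.diagonal (a, d) = blockOperator i j a 0 0 d := rfl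

lemma continuous_diagonal : Continuous hij.diagonal := by
  change Continuous fun z : (H →L[ℂ] H) × (H →L[ℂ] H) ↦ blockOperator i j z.1 0 0 z.2
  unfold blockOperator
  fun_prop

lemma cfc_blockOperator_diagonal (f : ℝ → ℝ) (a d : H →L[ℂ] H) (ha : IsSelfAdjoint a)
    (hd : IsSelfAdjoint d) (hf : ContinuousOn f (spectrum ℝ a ∪ spectrum ℝ d)) :
    cfc f (blockOperator i j a 0 0 d) = blockOperator i j (cfc f a) 0 0 (cfc f d) := by
  exact cfc_starAlgHom_prod hij.diagonal hij.continuous_diagonal f a d ha hd hf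

end IsOrthogonalDecomposition

/-- Every Hilbert space `H` has the Hilbert space direct sum `H ⊕ H`. -/
lemma isOrthogonalDecomposition_withLp :
    IsOrthogonalDecomposition
      ((WithLp.prodContinuousLinearEquiv 2 ℂ H H).symm.toContinuousLinearMap ∘L
        ContinuousLinearMap.inl ℂ H H)
      ((WithLp.prodContinuousLinearEquiv 2 ℂ H H).symm.toContinuousLinearMap ∘L
        ContinuousLinearMap.inr ℂ H H) := by
  set e := (WithLp.prodContinuousLinearEquiv 2 ℂ H H)
  have hl : adjoint (e.symm.toContinuousLinearMap ∘L ContinuousLinearMap.inl ℂ H H) =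
      ContinuousLinearMap.fst ℂ H H ∘L e.toContinuousLinearMap := by
    refine ((eq_adjoint_iff _ _).2 fun x y ↦ ?_).symm
    simp [e, WithLp.prod_inner_apply]
  have hr : adjoint (e.symm.toContinuousLinearMap ∘L ContinuousLinearMap.inr ℂ H H) =
      ContinuousLinearMap.snd ℂ H H ∘L e.toContinuousLinearMap := by
    refine ((eq_adjoint_iff _ _).2 fun x y ↦ ?_).symm
    simp [e, WithLp.prod_inner_apply]
  constructor
  · simp [hl]
  · simp [hr]
  · simp [hl]
  · simp [hr]
  · intro k
    rw [hl, hr]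
    apply e.injective
    ext <;> simp

lemma blockOperator_average (i j : H →L[ℂ] K) (a b c d : H →L[ℂ] H) :
    (1 / 2 : ℝ) • blockOperator i j a b c d +
        (1 - 1 / 2 : ℝ) • blockOperator i j a (-b) (-c) d = blockOperator i j a 0 0 d := by
  have h : (1 - 1 / 2 : ℝ) = 1 / 2 := by norm_num
  rw [h, ← smul_add]
  ext k
  simp only [blockOperator, smul_apply, add_apply, comp_apply, neg_apply, zero_apply, map_neg,
    map_zero]
  module

lemma adjoint_comp_comp_mono (i : H →L[ℂ] K) {S T : K →L[ℂ] K} (h : S ≤ T) :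
    adjoint i ∘L S ∘L i ≤ adjoint i ∘L T ∘L i := by
  rw [ContinuousLinearMap.le_def] at h ⊢
  simpa [ContinuousLinearMap.comp_sub, ContinuousLinearMap.sub_comp] using h.adjoint_conj i

end Orthogonal

lemma cfc_star_mul_mul_unitary {A : Type*} [CStarAlgebra A] (f : ℝ → ℝ) (u a : A)
    (hu : u ∈ unitary A) (ha : IsSelfAdjoint a) (hf : ContinuousOn f (spectrum ℝ a)) :
    cfc f (star u * a * u) = star u * cfc f a * u := by
  have h := (Unitary.conjStarAlgAut ℂ A (star ⟨u, hu⟩)).toStarAlgHom.map_cfc f a hf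
    (by change Continuous fun x ↦ star u * x * star (star u); fun_prop) ha
    (ha.map _)
  simpa [Unitary.conjStarAlgAut_apply] using h.symm

lemma spectrum_star_mul_mul_unitary {A : Type*} [CStarAlgebra A] (u a : A) (hu : u ∈ unitary A) :
    spectrum ℝ (star u * a * u) = spectrum ℝ a :=
  spectrum.units_conjugate' (u := Unitary.toUnits ⟨u, hu⟩)


lemma spectrum_subset_Icc_iff {A : Type*} [CStarAlgebra A] [PartialOrder A] [StarOrderedRing A]
    {a : A} (ha : IsSelfAdjoint a) (r s : ℝ) :
    spectrum ℝ a ⊆ Set.Icc r s ↔ algebraMap ℝ A r ≤ a ∧ a ≤ algebraMap ℝ A s := by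
  rw [algebraMap_le_iff_le_spectrum ha, le_algebraMap_iff_spectrum_le ha]
  exact forall₂_and

/-- The spectrum of `v* x v + w* x w` with `v* v + w* w = 1` stays in any interval
containing the spectrum of `x`. -/
lemma spectrum_star_mul_mul_add_subset {A : Type*} [CStarAlgebra A] [PartialOrder A]
    [StarOrderedRing A] {x v w : A} (hx : IsSelfAdjoint x) (hvw : star v * v + star w * w = 1)
    {I : Set ℝ} (hI : I.OrdConnected) (hxI : spectrum ℝ x ⊆ I) :
    spectrum ℝ (star v * x * v + star w * x * w) ⊆ I := by
  rcases subsingleton_or_nontrivial A with _ | _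
  · rwa [Subsingleton.elim (star v * x * v + star w * x * w) x]
  have hne : (spectrum ℝ x).Nonempty := ContinuousFunctionalCalculus.spectrum_nonempty x hx
  have hcomp : IsCompact (spectrum ℝ x) := ContinuousFunctionalCalculus.isCompact_spectrum x
  obtain ⟨r, hr, hrx⟩ := hcomp.exists_isLeast hne
  obtain ⟨s, hs, hsx⟩ := hcomp.exists_isGreatest hne
  refine Set.Subset.trans ?_ (hI.out (hxI hr) (hxI hs))
  obtain ⟨h₁, h₂⟩ := (spectrum_subset_Icc_iff hx r s).1 fun t ht ↦ ⟨hrx ht, hsx ht⟩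
  have hscalar (t : ℝ) :
      star v * algebraMap ℝ A t * v + star w * algebraMap ℝ A t * w = algebraMap ℝ A t := by
    simp [Algebra.algebraMap_eq_smul_one, ← smul_add, hvw]
  refine (spectrum_subset_Icc_iff
    ((hx.conjugate' v).add (hx.conjugate' w)) r s).2 ⟨?_, ?_⟩
  · rw [← hscalar r]
    exact add_le_add (star_left_conjugate_le_conjugate h₁ v)
      (star_left_conjugate_le_conjugate h₁ w)
  · rw [← hscalar s]
    exact add_le_add (star_left_conjugate_le_conjugate h₂ v)
      (star_left_conjugate_le_conjugate h₂ w)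

lemma mul_star_eq_one_of_finiteDimensional {H : Type*} [NormedAddCommGroup H]
    [InnerProductSpace ℂ H] [CompleteSpace H] [FiniteDimensional ℂ H] {v : H →L[ℂ] H}
    (hv : star v * v = 1) : v * star v = 1 := by
  have h : (star v : H →L[ℂ] H).toLinearMap * v.toLinearMap = 1 :=
    congrArg ContinuousLinearMap.toLinearMap hv
  exact ContinuousLinearMap.coe_injective (mul_eq_one_comm.1 h)

/-- If `f` is continuous on an interval `I ⊆ ℝ` and operator convex on `I`, then
`f(v* x v) ≤ v* f(x) v` for every isometry `v` on a complex Hilbert space `H` and every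
bounded self-adjoint operator `x` on `H` with spectrum in `I`. -/
theorem jensen_operator_inequality_isometry
    (f : ℝ → ℝ) (I : Set ℝ) (hI : I.OrdConnected) (hf : ContinuousOn f I)
    (hconv : OperatorConvexOn f I)
    (H : Type) [NormedAddCommGroup H] [InnerProductSpace ℂ H] [CompleteSpace H]
    (v x : H →L[ℂ] H) (hv : star v * v = 1)
    (hx : IsSelfAdjoint x) (hxI : spectrum ℝ x ⊆ I) :
    cfc f (star v * x * v) ≤ star v * cfc f x * v := by
  by_cases hfin : FiniteDimensional ℂ H
  · have hu : v ∈ unitary (H →L[ℂ] H) := ⟨hv, mul_star_eq_one_of_finiteDimensional hv⟩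
    exact (cfc_star_mul_mul_unitary f v x hu hx (hf.mono hxI)).le
  let K := WithLp 2 (H × H)
  obtain ⟨i, j, hij⟩ : ∃ i j : H →L[ℂ] K, IsOrthogonalDecomposition i j :=
    ⟨_, _, isOrthogonalDecomposition_withLp⟩
  have hK : ¬ FiniteDimensional ℂ K := fun _ ↦ hfin <|
    FiniteDimensional.of_injective i.toLinearMap
      (Function.LeftInverse.injective (g := adjoint i) hij.adjoint_left_left)
  set p : H →L[ℂ] H := 1 - v * star v with hp
  have hps : star p = p := by simp [hp]
  have hpv : p * v = 0 := by simp [hp, sub_mul, mul_assoc, hv]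
  have hvp : star v * p = 0 := by simp [hp, mul_sub, ← mul_assoc, hv]
  have hpp : p * p = p := by nth_rw 1 [hp]; simp [sub_mul, mul_assoc, hvp]
  have hsum : p + v * star v = 1 := by simp [hp]
  let u : K →L[ℂ] K := blockOperator i j v p 0 (star v)
  let w : K →L[ℂ] K := blockOperator i j 1 0 0 (-1)
  have hu : u ∈ unitary (K →L[ℂ] K) := by
    constructor <;>
    simp only [u, star_blockOperator, hij.blockOperator_mul, ← hij.blockOperator_one] <;>
    congr 1 <;> simp [hv, hps, hpv, hvp, hpp, hsum, add_comm (v * star v)]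
  have hw : w ∈ unitary (K →L[ℂ] K) := by
    constructor <;>
    simp [w, star_blockOperator, hij.blockOperator_mul, ← hij.blockOperator_one]
  have hconj (y : H →L[ℂ] H) : star u * blockOperator i j y 0 0 y * u =
      blockOperator i j (star v * y * v) (star v * y * p) (p * y * v)
        (p * y * p + v * y * star v) := by
    simp [u, star_blockOperator, hij.blockOperator_mul, hps]
  have hflip (a b c d : H →L[ℂ] H) : star w * blockOperator i j a b c d * w =
      blockOperator i j a (-b) (-c) d := by
    simp [w, star_blockOperator, hij.blockOperator_mul]
  set X : K →L[ℂ] K := blockOperator i j x 0 0 x with hX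
  have hXs : IsSelfAdjoint X := by
    simp [hX, IsSelfAdjoint, star_blockOperator, hx.star_eq]
  have hXspec : spectrum ℝ X ⊆ I := by
    refine Set.Subset.trans ?_ hxI
    have h := AlgHom.spectrum_apply_subset (hij.diagonal.restrictScalars ℝ) (x, x)
    rw [Prod.spectrum_eq, Set.union_self] at h
    exact h
  have hAs : IsSelfAdjoint (star u * X * u) := hXs.conjugate' u
  have hAspec : spectrum ℝ (star u * X * u) ⊆ I := by
    rwa [spectrum_star_mul_mul_unitary u X hu]
  have hcfcX : cfc f X = blockOperator i j (cfc f x) 0 0 (cfc f x) :=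
    hij.cfc_blockOperator_diagonal f x x hx hx (by simpa using hf.mono hxI)
  have hjensen := hconv K hK (star u * X * u) (star w * (star u * X * u) * w) hAs
    (hAs.conjugate' w) hAspec (by rwa [spectrum_star_mul_mul_unitary w _ hw]) (1 / 2)
    (by norm_num)
  rw [cfc_star_mul_mul_unitary f w _ hw hAs (hf.mono hAspec),
    cfc_star_mul_mul_unitary f u X hu hXs (hf.mono hXspec), hcfcX, hX, hconj, hconj, hflip, hflip,
    blockOperator_average, blockOperator_average] at hjensen
  have hspec₁ : spectrum ℝ (star v * x * v) ⊆ I := by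
    simpa using spectrum_star_mul_mul_add_subset (v := v) (w := 0) hx (by simpa using hv) hI hxI
  have hspec₂ : spectrum ℝ (p * x * p + v * x * star v) ⊆ I := by
    simpa [hps] using spectrum_star_mul_mul_add_subset (v := p) (w := star v) hx
      (by simp [hps, hpp, hsum]) hI hxI
  have hd : IsSelfAdjoint (p * x * p + v * x * star v) := by
    simpa [hps] using (hx.conjugate' p).add (hx.conjugate v)
  rw [hij.cfc_blockOperator_diagonal f _ _ (hx.conjugate' v) hd
    (hf.mono (Set.union_subset hspec₁ hspec₂))] at hjensen
  simpa only [hij.adjoint_comp_blockOperator_comp] using adjoint_comp_comp_mono i hjensen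
end

section
/- Let f be a continuous real function on an interval I ⊆ ℝ and let H be an infinite-dimensional complex Hilbert space. Suppose that f(v* x v) ≤ v* f(x) v for every isometry v on H and every bounded self-adjoint operator x on H with spectrum contained in I. Then for every orthogonal projection p on H (of finite or infinite rank), every bounded self-adjoint operator x on H with spectrum contained in I, and every s ∈ I, one has the pinching inequality p f(p x p + s(1 − p)) p ≤ p f(x) p. -/
section CuntzPair

variable {A : Type*} [CStarAlgebra A]

/-- The unital block-diagonal embedding `(a, b) ↦ w₁ a w₁* + w₂ b w₂*` associated with two
isometries `w₁`, `w₂` whose ranges are complementary. -/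
noncomputable def blockDiagonalHom (w₁ w₂ : A) (h₁ : star w₁ * w₁ = 1) (h₂ : star w₂ * w₂ = 1)
    (h₁₂ : star w₁ * w₂ = 0) (hsum : w₁ * star w₁ + w₂ * star w₂ = 1) : A × A →⋆ₐ[ℂ] A where
  toFun a := w₁ * a.1 * star w₁ + w₂ * a.2 * star w₂
  map_one' := by simpa using hsum
  map_mul' a b := by
    have h₂₁ : star w₂ * w₁ = 0 := by simpa using congrArg star h₁₂
    have key (x y c d : A) : x * star c * (d * y) = x * (star c * d) * y := by noncomm_ring
    simp only [Prod.fst_mul, Prod.snd_mul, add_mul, mul_add]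
    simp only [mul_assoc w₁ b.1, mul_assoc w₂ b.2, key, h₁, h₂, h₁₂, h₂₁]
    simp [mul_assoc]
  map_zero' := by simp
  map_add' a b := by
    simp only [Prod.fst_add, Prod.snd_add]
    noncomm_ring
  commutes' r := by
    simp only [Algebra.algebraMap_eq_smul_one, Prod.smul_fst, Prod.smul_snd, Prod.fst_one,
      Prod.snd_one, mul_smul_comm, mul_one, smul_mul_assoc, ← smul_add, hsum]
  map_star' a := by simp [mul_assoc]

theorem cfc_blockDiagonalHom (w₁ w₂ : A) (h₁ : star w₁ * w₁ = 1) (h₂ : star w₂ * w₂ = 1)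
    (h₁₂ : star w₁ * w₂ = 0) (hsum : w₁ * star w₁ + w₂ * star w₂ = 1)
    (f : ℝ → ℝ) {a b : A} (ha : IsSelfAdjoint a) (hb : IsSelfAdjoint b)
    (hf : ContinuousOn f (spectrum ℝ a ∪ spectrum ℝ b)) :
    cfc f (blockDiagonalHom w₁ w₂ h₁ h₂ h₁₂ hsum (a, b)) =
      blockDiagonalHom w₁ w₂ h₁ h₂ h₁₂ hsum (cfc f a, cfc f b) := by
  have : ContinuousFunctionalCalculus ℝ (A × A) IsSelfAdjoint :=
    IsSelfAdjoint.instContinuousFunctionalCalculus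
  have hab : IsSelfAdjoint (a, b) := Prod.ext ha hb
  rw [← cfc_map_prod (S := ℂ) f a b hf hab ha hb]
  refine (StarAlgHom.map_cfc (blockDiagonalHom w₁ w₂ h₁ h₂ h₁₂ hsum) f (a, b)
    (by rwa [Prod.spectrum_eq]) ?_ hab (hab.map _)).symm
  change Continuous fun c : A × A => w₁ * c.1 * star w₁ + w₂ * c.2 * star w₂
  fun_prop

/-- If `f` satisfies Jensen's operator inequality for isometries in a C⋆-algebra containing two
isometries with complementary ranges, then `f` satisfies the pinching inequality there. -/
theorem pinching_of_isometry_jensen [PartialOrder A] [StarOrderedRing A]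
    (w₁ w₂ : A) (h₁ : star w₁ * w₁ = 1) (h₂ : star w₂ * w₂ = 1)
    (h₁₂ : star w₁ * w₂ = 0) (hsum : w₁ * star w₁ + w₂ * star w₂ = 1)
    {f : ℝ → ℝ} {I : Set ℝ} (hf : ContinuousOn f I)
    (hyp : ∀ v x : A, star v * v = 1 → IsSelfAdjoint x → spectrum ℝ x ⊆ I →
      cfc f (star v * x * v) ≤ star v * cfc f x * v)
    {p x : A} (hp : IsSelfAdjoint p) (hp2 : p * p = p)
    (hx : IsSelfAdjoint x) (hxI : spectrum ℝ x ⊆ I) {s : ℝ} (hs : s ∈ I) :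
    p * cfc f (p * x * p + s • (1 - p)) * p ≤ p * cfc f x * p := by
  have hsI : spectrum ℝ (algebraMap ℝ A s) ⊆ I := by
    rcases subsingleton_or_nontrivial A with _ | _
    · simp [spectrum.of_subsingleton]
    · simpa using hs
  have hssa : IsSelfAdjoint (algebraMap ℝ A s) := .algebraMap A (.all s)
  set φ := blockDiagonalHom w₁ w₂ h₁ h₂ h₁₂ hsum with hφ
  have h₂₁ : star w₂ * w₁ = 0 := by simpa using congrArg star h₁₂
  set v := w₁ * p + w₂ * (1 - p) with hv
  have hv₁ : star w₁ * v = p := by simp [hv, mul_add, ← mul_assoc, h₁, h₁₂]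
  have hv₂ : star w₂ * v = 1 - p := by
    rw [hv, mul_add, ← mul_assoc, ← mul_assoc, h₂, h₂₁, zero_mul, one_mul, zero_add]
  have hv₁' : star v * w₁ = p := by simpa [hp.star_eq] using congrArg star hv₁
  have hv₂' : star v * w₂ = 1 - p := by simpa [hp.star_eq] using congrArg star hv₂
  have hpq : p * (1 - p) = 0 := by rw [mul_sub, mul_one, hp2, sub_self]
  have hq2 : (1 - p) * (1 - p) = 1 - p := by rw [sub_mul, one_mul, hpq, sub_zero]
  have compress (a : A) (t : ℝ) :
      star v * φ (a, algebraMap ℝ A t) * v = p * a * p + t • (1 - p) := by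
    calc star v * (w₁ * a * star w₁ + w₂ * algebraMap ℝ A t * star w₂) * v
        = (star v * w₁) * a * (star w₁ * v)
          + (star v * w₂) * algebraMap ℝ A t * (star w₂ * v) := by noncomm_ring
      _ = p * a * p + t • (1 - p) := by
        rw [hv₁, hv₂, hv₁', hv₂', Algebra.algebraMap_eq_smul_one, mul_smul_comm, mul_one,
          smul_mul_assoc, hq2]
  have hviso : star v * v = 1 := by
    have := compress 1 1
    rw [map_one, ← Prod.one_eq_mk, map_one] at this
    simpa [hp2] using this
  have hspec : spectrum ℝ (φ (x, algebraMap ℝ A s)) ⊆ I := by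
    refine (AlgHom.spectrum_apply_subset (φ.restrictScalars ℝ) (x, algebraMap ℝ A s)).trans ?_
    rw [Prod.spectrum_eq]
    exact Set.union_subset hxI hsI
  have hsa : IsSelfAdjoint (x, algebraMap ℝ A s) := Prod.ext hx hssa
  have jensen := hyp v _ hviso (hsa.map φ) hspec
  rw [hφ, cfc_blockDiagonalHom w₁ w₂ h₁ h₂ h₁₂ hsum f hx hssa
    (hf.mono (Set.union_subset hxI hsI)), cfc_algebraMap s f, ← hφ, compress, compress] at jensen
  have pinched := star_left_conjugate_le_conjugate jensen p
  rw [hp.star_eq] at pinched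
  refine pinched.trans_eq ?_
  calc p * (p * cfc f x * p + f s • (1 - p)) * p
      = (p * p) * cfc f x * (p * p) + f s • (p * (1 - p) * p) := by
        simp only [mul_add, add_mul, mul_smul_comm, smul_mul_assoc, mul_assoc]
    _ = p * cfc f x * p := by rw [hp2, hpq, zero_mul, smul_zero, add_zero]

end CuntzPair

section HilbertSpace

variable {H : Type*} [NormedAddCommGroup H] [InnerProductSpace ℂ H]

theorem HilbertBasis.continuousLinearMap_ext {ι : Type*} (b : HilbertBasis ι ℂ H)
    {S T : H →L[ℂ] H} (h : ∀ i, S (b i) = T (b i)) : S = T := by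
  refine ContinuousLinearMap.ext_on (s := Set.range b) ?_ ?_
  · rw [Submodule.dense_iff_topologicalClosure_eq_top]
    exact b.dense_span
  · rintro _ ⟨i, rfl⟩
    exact h i

variable [CompleteSpace H]

theorem HilbertBasis.exists_isometry_map_eq {ι : Type*} (b : HilbertBasis ι ℂ H)
    {u : ι → H} (hu : Orthonormal ℂ u) :
    ∃ w : H →L[ℂ] H, star w * w = 1 ∧ ∀ i, w (b i) = u i := by
  classical
  let W : H →ₗᵢ[ℂ] H :=
    hu.orthogonalFamily.linearIsometry.comp b.repr.toLinearIsometry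
  refine ⟨W.toContinuousLinearMap, ?_, fun i => ?_⟩
  · rw [ContinuousLinearMap.star_eq_adjoint]
    exact (ContinuousLinearMap.norm_map_iff_adjoint_comp_self _).1 W.norm_map
  · change hu.orthogonalFamily.linearIsometry (b.repr (b i)) = u i
    rw [b.repr_self, OrthogonalFamily.linearIsometry_apply_single]
    simp

theorem exists_isometries_complementary_ranges (hdim : ¬ FiniteDimensional ℂ H) :
    ∃ w₁ w₂ : H →L[ℂ] H, star w₁ * w₁ = 1 ∧ star w₂ * w₂ = 1 ∧ star w₁ * w₂ = 0 ∧
      w₁ * star w₁ + w₂ * star w₂ = 1 := by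
  obtain ⟨ι, b, -⟩ := exists_hilbertBasis ℂ H
  have : Infinite ι := by
    rw [← not_finite_iff_infinite]
    intro _
    have := Fintype.ofFinite ι
    exact hdim b.toOrthonormalBasis.toBasis.finiteDimensional_of_finite
  obtain ⟨e⟩ : Nonempty (ι ⊕ ι ≃ ι) := Cardinal.eq.1 (by simp)
  obtain ⟨w₁, h₁, hw₁⟩ :=
    b.exists_isometry_map_eq (b.orthonormal.comp _ (e.injective.comp Sum.inl_injective))
  obtain ⟨w₂, h₂, hw₂⟩ :=
    b.exists_isometry_map_eq (b.orthonormal.comp _ (e.injective.comp Sum.inr_injective))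
  have h₁₂ : star w₁ * w₂ = 0 := by
    refine b.continuousLinearMap_ext fun j => b.repr.injective ?_
    ext i
    rw [b.repr_apply_apply, b.repr_apply_apply, ContinuousLinearMap.star_eq_adjoint,
      mul_apply_eq_comp, ContinuousLinearMap.adjoint_inner_right, hw₁, hw₂]
    simpa using b.orthonormal.2 (e.injective.ne Sum.inl_ne_inr)
  have h₂₁ : star w₂ * w₁ = 0 := by simpa using congrArg star h₁₂
  refine ⟨w₁, w₂, h₁, h₂, h₁₂, b.continuousLinearMap_ext fun k => ?_⟩
  obtain ⟨k | k, rfl⟩ := e.surjective k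
  · have hk : b (e (.inl k)) = w₁ (b k) := (hw₁ k).symm
    rw [hk]
    change ((w₁ * star w₁ + w₂ * star w₂) * w₁) (b k) = w₁ (b k)
    rw [add_mul, mul_assoc, mul_assoc, h₁, h₂₁, mul_one, mul_zero, add_zero]
  · have hk : b (e (.inr k)) = w₂ (b k) := (hw₂ k).symm
    rw [hk]
    change ((w₁ * star w₁ + w₂ * star w₂) * w₂) (b k) = w₂ (b k)
    rw [add_mul, mul_assoc, mul_assoc, h₂, h₁₂, mul_one, mul_zero, zero_add]

end HilbertSpace


/-- **The pinching inequality.** Let `f` be continuous on an interval `I ⊆ ℝ` and let `H` be an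
infinite-dimensional complex Hilbert space.  If `f(v* x v) ≤ v* f(x) v` for every isometry `v`
on `H` and every bounded self-adjoint `x` on `H` with spectrum in `I`, then for every orthogonal
projection `p` on `H`, every bounded self-adjoint `x` on `H` with spectrum in `I` and every
`s ∈ I` one has `p f(p x p + s(1 − p)) p ≤ p f(x) p`. -/
theorem pinching_inequality
    (f : ℝ → ℝ) (I : Set ℝ) (hI : I.OrdConnected) (hf : ContinuousOn f I)
    (H : Type) [NormedAddCommGroup H] [InnerProductSpace ℂ H] [CompleteSpace H]
    (hdim : ¬ FiniteDimensional ℂ H)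
    (hyp : ∀ v x : H →L[ℂ] H, star v * v = 1 → IsSelfAdjoint x → spectrum ℝ x ⊆ I →
      cfc f (star v * x * v) ≤ star v * cfc f x * v)
    (p x : H →L[ℂ] H) (hp : IsSelfAdjoint p) (hp2 : p * p = p)
    (hx : IsSelfAdjoint x) (hxI : spectrum ℝ x ⊆ I) (s : ℝ) (hs : s ∈ I) :
    p * cfc f (p * x * p + s • (1 - p)) * p ≤ p * cfc f x * p := by
  obtain ⟨w₁, w₂, h₁, h₂, h₁₂, hsum⟩ := exists_isometries_complementary_ranges hdim
  exact pinching_of_isometry_jensen w₁ w₂ h₁ h₂ h₁₂ hsum hf hyp hp hp2 hx hxI hs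
end

section
/- Let f be a continuous real function on an interval I ⊆ ℝ and let H be an infinite-dimensional complex Hilbert space. Suppose that p f(p x p + s(1 − p)) p ≤ p f(x) p for every orthogonal projection p on H, every bounded self-adjoint operator x on H with spectrum contained in I, and every s ∈ I. Then f is operator convex on I. -/
section Operators

open ContinuousLinearMap

variable {E F : Type*} [NormedAddCommGroup E] [InnerProductSpace ℂ E]
  [NormedAddCommGroup F] [InnerProductSpace ℂ F]

/-- An infinite-dimensional inner product space contains an isometric copy of every
finite-dimensional one. -/
theorem exists_linearIsometry_of_not_finiteDimensional [FiniteDimensional ℂ F]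
    (hE : ¬ FiniteDimensional ℂ E) : Nonempty (F →ₗᵢ[ℂ] E) := by
  have hrank : (Module.finrank ℂ F : Cardinal) ≤ Module.rank ℂ E := by
    have : Cardinal.aleph0 ≤ Module.rank ℂ E := by
      rw [← not_lt]
      exact fun h => hE (Module.rank_lt_aleph0_iff.mp h)
    exact (Cardinal.natCast_lt_aleph0).le.trans this
  obtain ⟨s, hs, hli⟩ := le_rank_iff_exists_linearIndependent_finset.mp hrank
  have hG : Module.finrank ℂ (Submodule.span ℂ (s : Set E)) = Module.finrank ℂ F := by
    rw [← hs]
    exact finrank_span_finset_eq_card hli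
  exact ⟨(Submodule.span ℂ (s : Set E)).subtypeₗᵢ.comp
    ((stdOrthonormalBasis ℂ F).equiv (stdOrthonormalBasis ℂ _)
      (finCongr hG.symm)).toLinearIsometry⟩

theorem LinearIsometry.not_finiteDimensional_range_orthogonal [FiniteDimensional ℂ F]
    (hE : ¬ FiniteDimensional ℂ E) (J : F →ₗᵢ[ℂ] E) :
    ¬ FiniteDimensional ℂ (LinearMap.range J.toLinearMap)ᗮ := by
  intro h
  have htop := Submodule.sup_orthogonal_of_hasOrthogonalProjection
    (K := LinearMap.range J.toLinearMap)
  have : FiniteDimensional ℂ (⊤ : Submodule ℂ E) := by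
    rw [← htop]
    infer_instance
  exact hE (Module.finite_def.mpr (Submodule.fg_top _ |>.mp (Module.finite_def.mp this)))

/-- An infinite-dimensional Hilbert space contains two orthogonal isometric copies of every
finite-dimensional inner product space. -/
theorem exists_orthogonal_isometries [CompleteSpace E] [CompleteSpace F] [FiniteDimensional ℂ F]
    (hE : ¬ FiniteDimensional ℂ E) :
    ∃ J₁ J₂ : F →L[ℂ] E, (∀ v, adjoint J₁ (J₁ v) = v) ∧ (∀ v, adjoint J₂ (J₂ v) = v) ∧
      (∀ v, adjoint J₁ (J₂ v) = 0) ∧ (∀ v, adjoint J₂ (J₁ v) = 0) := by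
  obtain ⟨J⟩ := exists_linearIsometry_of_not_finiteDimensional (F := F) hE
  obtain ⟨L⟩ := exists_linearIsometry_of_not_finiteDimensional (F := F)
    (J.not_finiteDimensional_range_orthogonal hE)
  refine ⟨J.toContinuousLinearMap, ((LinearMap.range J.toLinearMap)ᗮ.subtypeₗᵢ.comp
    L).toContinuousLinearMap, fun v => ?_, fun v => ?_, fun v => ?_, fun v => ?_⟩ <;>
    refine ext_inner_left ℂ fun w => ?_ <;> rw [adjoint_inner_right]
  · exact J.inner_map_map w v
  · exact LinearIsometry.inner_map_map _ w v
  · rw [inner_zero_right]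
    exact (L v).2 _ ⟨w, rfl⟩
  · rw [inner_zero_right]
    exact Submodule.inner_left_of_mem_orthogonal (K := LinearMap.range J.toLinearMap)
      ⟨v, rfl⟩ (L w).2

theorem aeval_intertwine {W : F →L[ℂ] E} {x : E →L[ℂ] E} {a : F →L[ℂ] F}
    (h : ∀ v, x (W v) = W (a v)) (q : Polynomial ℝ) (v : F) :
    Polynomial.aeval x q (W v) = W (Polynomial.aeval a q v) := by
  have hpow (k : ℕ) : (x ^ k) (W v) = W ((a ^ k) v) := by
    induction k with
    | zero => simp
    | succ k ih => rw [pow_succ', pow_succ', mul_apply_eq_comp, mul_apply_eq_comp, ih, h]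
  simp [Polynomial.aeval_eq_sum_range, hpow, sum_apply]

theorem re_inner_le_of_le {x y : E →L[ℂ] E} (h : x ≤ y) (v : E) :
    (inner ℂ (x v) v).re ≤ (inner ℂ (y v) v).re := by
  rw [le_def, isPositive_def] at h
  simpa [reApplyInnerSelf, inner_sub_left] using h.2 v

theorem re_inner_convexComb (a b : E →L[ℂ] E) (t : ℝ) (v : E) :
    (inner ℂ ((t • a + (1 - t) • b) v) v).re =
      t * (inner ℂ (a v) v).re + (1 - t) * (inner ℂ (b v) v).re := by
  simp [inner_smul_left_eq_smul]

section CFC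

variable [CompleteSpace E] [CompleteSpace F]

theorem norm_aeval_sub_cfc_le {f : ℝ → ℝ} {α β ε : ℝ} (hε : 0 ≤ ε)
    (hf : ContinuousOn f (Set.Icc α β)) {q : Polynomial ℝ}
    (hq : ∀ r ∈ Set.Icc α β, |q.eval r - f r| ≤ ε) {x : E →L[ℂ] E} (hx : IsSelfAdjoint x)
    (hσ : spectrum ℝ x ⊆ Set.Icc α β) : ‖Polynomial.aeval x q - cfc f x‖ ≤ ε := by
  rw [← cfc_polynomial q x hx, ← cfc_sub _ _ x (by fun_prop) (hf.mono hσ)]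
  exact norm_cfc_le hε fun r hr => hq r (hσ hr)

theorem cfc_intertwine {f : ℝ → ℝ} {α β : ℝ} (hf : ContinuousOn f (Set.Icc α β))
    {W : F →L[ℂ] E} {x : E →L[ℂ] E} {a : F →L[ℂ] F} (hx : IsSelfAdjoint x)
    (ha : IsSelfAdjoint a) (hσx : spectrum ℝ x ⊆ Set.Icc α β)
    (hσa : spectrum ℝ a ⊆ Set.Icc α β) (h : ∀ v, x (W v) = W (a v)) (v : F) :
    cfc f x (W v) = W (cfc f a v) := by
  refine eq_of_forall_dist_le fun ε hε => ?_
  set C := 2 * ‖W‖ * ‖v‖ + 1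
  have hC : 0 < C := by positivity
  obtain ⟨q, hq⟩ := exists_polynomial_near_of_continuousOn α β f hf (ε / C) (by positivity)
  have hx' := norm_aeval_sub_cfc_le (by positivity) hf (fun r hr => (hq r hr).le) hx hσx
  have ha' := norm_aeval_sub_cfc_le (by positivity) hf (fun r hr => (hq r hr).le) ha hσa
  have h1 := le_of_opNorm_le _ hx' (W v)
  have h2 := (W.le_opNorm _).trans
    (mul_le_mul_of_nonneg_left (le_of_opNorm_le _ ha' v) (norm_nonneg W))
  have h3 : ε / C * ‖W v‖ ≤ ε / C * (‖W‖ * ‖v‖) := by gcongr; exact W.le_opNorm v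
  have key : cfc f x (W v) - W (cfc f a v) =
      W ((Polynomial.aeval a q - cfc f a) v) - (Polynomial.aeval x q - cfc f x) (W v) := by
    simp [aeval_intertwine h]
  rw [dist_eq_norm, key]
  calc _ ≤ _ := norm_sub_le _ _
    _ ≤ ε / C * (2 * ‖W‖ * ‖v‖) := by linarith
    _ ≤ ε / C * C := by gcongr; simp [C]
    _ = ε := by field_simp

theorem spectrum_subset_Icc_iff_s3 {α β : ℝ} {x : E →L[ℂ] E} (hx : IsSelfAdjoint x) :
    spectrum ℝ x ⊆ Set.Icc α β ↔
      (x - algebraMap ℝ (E →L[ℂ] E) α).IsPositive ∧ (algebraMap ℝ (E →L[ℂ] E) β - x).IsPositive := by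
  rw [← le_def, ← le_def, algebraMap_le_iff_le_spectrum hx, le_algebraMap_iff_spectrum_le hx]
  exact ⟨fun h => ⟨fun r hr => (h hr).1, fun r hr => (h hr).2⟩,
    fun h r hr => ⟨h.1 r hr, h.2 r hr⟩⟩

theorem le_of_re_inner_le {x y : E →L[ℂ] E} (hx : IsSelfAdjoint x) (hy : IsSelfAdjoint y)
    (h : ∀ v, (inner ℂ (x v) v).re ≤ (inner ℂ (y v) v).re) : x ≤ y := by
  rw [le_def, isPositive_def]
  refine ⟨(hy.sub hx).isSymmetric, fun v => ?_⟩
  simpa [reApplyInnerSelf, inner_sub_left] using h v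

/-- The operator acting as `a` and `b` on two orthogonal copies of `F` and as the scalar `s` on
the rest. -/
noncomputable def blockSum (W₁ W₂ : F →L[ℂ] E) (a b : F →L[ℂ] F) (s : ℝ) : E →L[ℂ] E :=
  W₁ ∘L a ∘L adjoint W₁ + W₂ ∘L b ∘L adjoint W₂ +
    s • (1 - W₁ ∘L adjoint W₁ - W₂ ∘L adjoint W₂)

theorem isSelfAdjoint_one_sub_sub (W₁ W₂ : F →L[ℂ] E) :
    IsSelfAdjoint (1 - W₁ ∘L adjoint W₁ - W₂ ∘L adjoint W₂) :=
  ((IsSelfAdjoint.one _).sub (isPositive_self_comp_adjoint W₁).isSelfAdjoint).sub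
    (isPositive_self_comp_adjoint W₂).isSelfAdjoint

theorem isSelfAdjoint_blockSum (W₁ W₂ : F →L[ℂ] E) {a b : F →L[ℂ] F} (ha : IsSelfAdjoint a)
    (hb : IsSelfAdjoint b) (s : ℝ) : IsSelfAdjoint (blockSum W₁ W₂ a b s) :=
  ((ha.conj_adjoint W₁).add (hb.conj_adjoint W₂)).add
    ((IsSelfAdjoint.all s).smul (isSelfAdjoint_one_sub_sub W₁ W₂))

theorem isPositive_blockSum {W₁ W₂ : F →L[ℂ] E} (h11 : ∀ v, adjoint W₁ (W₁ v) = v)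
    (h22 : ∀ v, adjoint W₂ (W₂ v) = v) (h12 : ∀ v, adjoint W₁ (W₂ v) = 0)
    (h21 : ∀ v, adjoint W₂ (W₁ v) = 0) {a b : F →L[ℂ] F} (ha : a.IsPositive)
    (hb : b.IsPositive) {s : ℝ} (hs : 0 ≤ s) : (blockSum W₁ W₂ a b s).IsPositive := by
  have hQ : (1 - W₁ ∘L adjoint W₁ - W₂ ∘L adjoint W₂ : E →L[ℂ] E).IsPositive := by
    convert isPositive_self_comp_adjoint (1 - W₁ ∘L adjoint W₁ - W₂ ∘L adjoint W₂) using 1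
    rw [(isSelfAdjoint_one_sub_sub W₁ W₂).adjoint_eq]
    ext v
    simp [h11, h22, h12, h21]
  refine ((ha.conj_adjoint W₁).add (hb.conj_adjoint W₂)).add ?_
  rw [← nonneg_iff_isPositive] at hQ ⊢
  exact smul_nonneg hs hQ

theorem spectrum_blockSum_subset {W₁ W₂ : F →L[ℂ] E} (h11 : ∀ v, adjoint W₁ (W₁ v) = v)
    (h22 : ∀ v, adjoint W₂ (W₂ v) = v) (h12 : ∀ v, adjoint W₁ (W₂ v) = 0)
    (h21 : ∀ v, adjoint W₂ (W₁ v) = 0) {a b : F →L[ℂ] F} (ha : IsSelfAdjoint a)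
    (hb : IsSelfAdjoint b) {α β s : ℝ} (hσa : spectrum ℝ a ⊆ Set.Icc α β)
    (hσb : spectrum ℝ b ⊆ Set.Icc α β) (hs : s ∈ Set.Icc α β) :
    spectrum ℝ (blockSum W₁ W₂ a b s) ⊆ Set.Icc α β := by
  rw [spectrum_subset_Icc_iff_s3 ha] at hσa
  rw [spectrum_subset_Icc_iff_s3 hb] at hσb
  rw [spectrum_subset_Icc_iff_s3 (isSelfAdjoint_blockSum W₁ W₂ ha hb s)]
  constructor
  · convert isPositive_blockSum h11 h22 h12 h21 hσa.1 hσb.1 (sub_nonneg.mpr hs.1) using 1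
    ext v
    simp [blockSum, Algebra.algebraMap_eq_smul_one]
    module
  · convert isPositive_blockSum h11 h22 h12 h21 hσa.2 hσb.2 (sub_nonneg.mpr hs.2) using 1
    ext v
    simp [blockSum, Algebra.algebraMap_eq_smul_one]
    module

theorem spectrum_convexComb_subset {a b : F →L[ℂ] F} (ha : IsSelfAdjoint a)
    (hb : IsSelfAdjoint b) {α β t : ℝ} (hσa : spectrum ℝ a ⊆ Set.Icc α β)
    (hσb : spectrum ℝ b ⊆ Set.Icc α β) (ht : t ∈ Set.Icc (0 : ℝ) 1) :
    spectrum ℝ (t • a + (1 - t) • b) ⊆ Set.Icc α β := by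
  have hsmul {c : F →L[ℂ] F} (hc : c.IsPositive) {r : ℝ} (hr : 0 ≤ r) : (r • c).IsPositive := by
    rw [← nonneg_iff_isPositive] at hc ⊢
    exact smul_nonneg hr hc
  rw [spectrum_subset_Icc_iff_s3 ha] at hσa
  rw [spectrum_subset_Icc_iff_s3 hb] at hσb
  rw [spectrum_subset_Icc_iff_s3 (((IsSelfAdjoint.all t).smul ha).add ((IsSelfAdjoint.all (1 - t)).smul hb))]
  have ht' : 0 ≤ 1 - t := sub_nonneg.mpr ht.2
  constructor
  · convert (hsmul hσa.1 ht.1).add (hsmul hσb.1 ht') using 1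
    simp only [Algebra.algebraMap_eq_smul_one]
    module
  · convert (hsmul hσa.2 ht.1).add (hsmul hσb.2 ht') using 1
    simp only [Algebra.algebraMap_eq_smul_one]
    module

theorem spectrum_compression_subset {V : F →L[ℂ] E} (hV : ∀ v, adjoint V (V v) = v)
    {x : E →L[ℂ] E} (hx : IsSelfAdjoint x) {α β : ℝ} (hσ : spectrum ℝ x ⊆ Set.Icc α β) :
    spectrum ℝ (adjoint V ∘L x ∘L V) ⊆ Set.Icc α β := by
  rw [spectrum_subset_Icc_iff_s3 hx] at hσ
  rw [spectrum_subset_Icc_iff_s3 (hx.adjoint_conj V)]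
  constructor
  · convert hσ.1.adjoint_conj V using 1
    ext v
    simp [Algebra.algebraMap_eq_smul_one, hV]
  · convert hσ.2.adjoint_conj V using 1
    ext v
    simp [Algebra.algebraMap_eq_smul_one, hV]

/-- The pinching inequality on `E` yields the convexity inequality on `F`, provided `E` contains
two orthogonal copies of `F`. -/
theorem cfc_convexComb_le_of_pinching {f : ℝ → ℝ} {α β : ℝ} (hαβ : α ≤ β)
    (hf : ContinuousOn f (Set.Icc α β))
    (hyp : ∀ p x : E →L[ℂ] E, IsSelfAdjoint p → p * p = p → IsSelfAdjoint x →
      spectrum ℝ x ⊆ Set.Icc α β →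
        p * cfc f (p * x * p + α • (1 - p)) * p ≤ p * cfc f x * p)
    {J₁ J₂ : F →L[ℂ] E} (h11 : ∀ v, adjoint J₁ (J₁ v) = v)
    (h22 : ∀ v, adjoint J₂ (J₂ v) = v) (h12 : ∀ v, adjoint J₁ (J₂ v) = 0)
    (h21 : ∀ v, adjoint J₂ (J₁ v) = 0) {a b : F →L[ℂ] F} (ha : IsSelfAdjoint a)
    (hb : IsSelfAdjoint b) (hσa : spectrum ℝ a ⊆ Set.Icc α β)
    (hσb : spectrum ℝ b ⊆ Set.Icc α β) {t : ℝ} (ht : t ∈ Set.Icc (0 : ℝ) 1) :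
    cfc f (t • a + (1 - t) • b) ≤ t • cfc f a + (1 - t) • cfc f b := by
  have hα : α ∈ Set.Icc α β := ⟨le_rfl, hαβ⟩
  obtain ⟨c, hc⟩ : ∃ c : ℝ, c * c = t := ⟨_, Real.mul_self_sqrt ht.1⟩
  obtain ⟨d, hd⟩ : ∃ d : ℝ, d * d = 1 - t := ⟨_, Real.mul_self_sqrt (sub_nonneg.mpr ht.2)⟩
  have hcd : c * c + d * d = 1 := by linarith
  set W₁ : F →L[ℂ] E := c • J₁ + d • J₂ with hW₁
  set W₂ : F →L[ℂ] E := d • J₁ - c • J₂ with hW₂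
  have hA₁ : adjoint W₁ = c • adjoint J₁ + d • adjoint J₂ := by
    refine ((eq_adjoint_iff _ _).mpr fun x y => ?_).symm
    simp [hW₁, inner_add_left, inner_add_right, adjoint_inner_left, inner_smul_left_eq_smul,
      inner_smul_right_eq_smul]
  have hA₂ : adjoint W₂ = d • adjoint J₁ - c • adjoint J₂ := by
    refine ((eq_adjoint_iff _ _).mpr fun x y => ?_).symm
    simp [hW₂, inner_sub_left, inner_sub_right, adjoint_inner_left, inner_smul_left_eq_smul,
      inner_smul_right_eq_smul]
  have k11 (v : F) : adjoint W₁ (W₁ v) = v := by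
    rw [hA₁]
    simp [hW₁, map_smul_of_tower, h11, h22, h12, h21, smul_smul, ← add_smul, hcd]
  have k22 (v : F) : adjoint W₂ (W₂ v) = v := by
    rw [hA₂]
    simp [hW₂, map_smul_of_tower, h11, h22, h12, h21, smul_smul, ← add_smul, add_comm (d * d), hcd]
  have k12 (v : F) : adjoint W₁ (W₂ v) = 0 := by
    rw [hA₁]
    simp [hW₂, map_smul_of_tower, h11, h22, h12, h21, smul_smul, mul_comm]
  have k21 (v : F) : adjoint W₂ (W₁ v) = 0 := by
    rw [hA₂]
    simp [hW₁, map_smul_of_tower, h11, h22, h12, h21, smul_smul, mul_comm]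
  have hJ (v : F) : J₁ v = c • W₁ v + d • W₂ v := by
    have : J₁ v = (c * c + d * d) • J₁ v := by rw [hcd, one_smul]
    rw [this]
    simp only [hW₁, hW₂, add_apply, sub_apply, smul_apply]
    module
  have hJa (v : E) : adjoint J₁ v = c • adjoint W₁ v + d • adjoint W₂ v := by
    have : adjoint J₁ v = (c * c + d * d) • adjoint J₁ v := by rw [hcd, one_smul]
    rw [this]
    simp only [hA₁, hA₂, add_apply, sub_apply, smul_apply]
    module
  set x := blockSum W₁ W₂ a b α with hx_def
  set p : E →L[ℂ] E := J₁ ∘L adjoint J₁ with hp_def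
  have hx : IsSelfAdjoint x := isSelfAdjoint_blockSum W₁ W₂ ha hb α
  have hσx : spectrum ℝ x ⊆ Set.Icc α β :=
    spectrum_blockSum_subset k11 k22 k12 k21 ha hb hσa hσb hα
  have hp : IsSelfAdjoint p := (isPositive_self_comp_adjoint J₁).isSelfAdjoint
  have hpp : p * p = p := by
    ext v
    simp [hp_def, h11]
  have hxW₁ (v : F) : x (W₁ v) = W₁ (a v) := by simp [hx_def, blockSum, k11, k21]
  have hxW₂ (v : F) : x (W₂ v) = W₂ (b v) := by simp [hx_def, blockSum, k12, k22]
  set m := t • a + (1 - t) • b with hm_def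
  have hm : IsSelfAdjoint m := ((IsSelfAdjoint.all t).smul ha).add ((IsSelfAdjoint.all (1 - t)).smul hb)
  have hσm : spectrum ℝ m ⊆ Set.Icc α β := spectrum_convexComb_subset ha hb hσa hσb ht
  have hz_eq : p * x * p + α • (1 - p) = blockSum J₁ J₂ m (algebraMap ℝ _ α) α := by
    ext v
    simp only [hp_def, blockSum, add_apply, mul_apply_eq_comp, smul_apply, sub_apply, comp_apply, one_apply_eq_self,
      Algebra.algebraMap_eq_smul_one, map_smul_of_tower]
    have : adjoint J₁ (x (J₁ (adjoint J₁ v))) = m (adjoint J₁ v) := by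
      rw [hJ, map_add, map_smul_of_tower, map_smul_of_tower, hxW₁, hxW₂, hJa]
      simp only [map_add, map_smul_of_tower, k11, k22, k12, k21, hm_def, add_apply, smul_apply,
        smul_zero, add_zero, zero_add, smul_smul, hc, hd]
    rw [this]
    module
  have hσα : spectrum ℝ (algebraMap ℝ (F →L[ℂ] F) α) ⊆ Set.Icc α β := by
    rw [spectrum_subset_Icc_iff_s3 (.algebraMap _ (.all α)), sub_self, ← map_sub]
    refine ⟨isPositive_zero, ?_⟩
    rw [← nonneg_iff_isPositive]
    exact algebraMap_nonneg _ (sub_nonneg.mpr hαβ)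
  have hα_sa : IsSelfAdjoint (algebraMap ℝ (F →L[ℂ] F) α) := .algebraMap _ (.all α)
  have hfz := cfc_intertwine hf (isSelfAdjoint_blockSum J₁ J₂ hm hα_sa α) hm
    (spectrum_blockSum_subset h11 h22 h12 h21 hm hα_sa hσm hσα hα) hσm
    (W := J₁) (fun v => by simp [blockSum, h11, h21])
  have hfa := cfc_intertwine hf hx ha hσx hσa hxW₁
  have hfb := cfc_intertwine hf hx hb hσx hσb hxW₂
  have key := hyp p x hp hpp hx hσx
  rw [hz_eq, le_def] at key
  rw [le_def]
  convert key.adjoint_conj J₁ using 1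
  ext v
  have hfx : adjoint J₁ (cfc f x (J₁ v)) = t • cfc f a v + (1 - t) • cfc f b v := by
    rw [hJ, map_add, map_smul_of_tower, map_smul_of_tower, hfa, hfb, hJa]
    simp only [map_add, map_smul_of_tower, k11, k22, k12, k21,
      smul_zero, add_zero, zero_add, smul_smul, hc, hd]
  simp [hp_def, h11, hfz, hfx]

theorem abs_re_inner_cfc_sub_le {f : ℝ → ℝ} {α β ε : ℝ} (hε : 0 ≤ ε)
    (hf : ContinuousOn f (Set.Icc α β)) {q : Polynomial ℝ}
    (hq : ∀ r ∈ Set.Icc α β, |q.eval r - f r| ≤ ε) {x : E →L[ℂ] E} (hx : IsSelfAdjoint x)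
    (hσ : spectrum ℝ x ⊆ Set.Icc α β) (v : E) :
    |(inner ℂ (Polynomial.aeval x q v) v).re - (inner ℂ (cfc f x v) v).re| ≤ ε * ‖v‖ ^ 2 := by
  rw [← Complex.sub_re, ← inner_sub_left, ← sub_apply]
  calc _ ≤ _ := Complex.abs_re_le_norm _
    _ ≤ _ := norm_inner_le_norm _ _
    _ ≤ ε * ‖v‖ * ‖v‖ := by
      gcongr
      exact le_of_opNorm_le _ (norm_aeval_sub_cfc_le hε hf hq hx hσ) v
    _ = _ := by ring

theorem inner_aeval_compression {V : F →L[ℂ] E} (hV : ∀ v, adjoint V (V v) = v)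
    (x : E →L[ℂ] E) (q : Polynomial ℝ) (u : F)
    (hmem : ∀ k ≤ q.natDegree, (x ^ k) (V u) ∈ Set.range V) :
    inner ℂ (Polynomial.aeval (adjoint V ∘L x ∘L V) q u) u =
      inner ℂ (Polynomial.aeval x q (V u)) (V u) := by
  have hpow (k : ℕ) (hk : k ≤ q.natDegree) :
      V (((adjoint V ∘L x ∘L V) ^ k) u) = (x ^ k) (V u) := by
    induction k with
    | zero => simp
    | succ k ih =>
      obtain ⟨w, hw⟩ := hmem _ hk
      rw [pow_succ', mul_apply_eq_comp] at hw
      rw [pow_succ', pow_succ', mul_apply_eq_comp, mul_apply_eq_comp, comp_apply, comp_apply,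
        ih (by omega), ← hw, hV]
  have hpow' (k : ℕ) (hk : k ≤ q.natDegree) :
      ((adjoint V ∘L x ∘L V) ^ k) u = adjoint V ((x ^ k) (V u)) := by
    rw [← hpow k hk, hV]
  rw [← adjoint_inner_left]
  congr 1
  simp only [Polynomial.aeval_eq_sum_range, sum_apply, map_sum, smul_apply, map_smul_of_tower]
  refine Finset.sum_congr rfl fun k hk => ?_
  rw [hpow' k (by simpa [Nat.lt_succ_iff] using hk)]

theorem abs_re_inner_cfc_compression_sub_le {f : ℝ → ℝ} {α β ε : ℝ} (hε : 0 ≤ ε)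
    (hf : ContinuousOn f (Set.Icc α β)) {q : Polynomial ℝ}
    (hq : ∀ r ∈ Set.Icc α β, |q.eval r - f r| ≤ ε) {V : F →L[ℂ] E}
    (hV : ∀ v, adjoint V (V v) = v) {x : E →L[ℂ] E} (hx : IsSelfAdjoint x)
    (hσ : spectrum ℝ x ⊆ Set.Icc α β) {u : F}
    (hmem : ∀ k ≤ q.natDegree, (x ^ k) (V u) ∈ Set.range V) :
    |(inner ℂ (cfc f (adjoint V ∘L x ∘L V) u) u).re - (inner ℂ (cfc f x (V u)) (V u)).re| ≤
      2 * (ε * ‖V u‖ ^ 2) := by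
  have hnorm : ‖V u‖ = ‖u‖ := by
    refine (sq_eq_sq₀ (norm_nonneg _) (norm_nonneg _)).mp ?_
    rw [← inner_self_eq_norm_sq (𝕜 := ℂ), ← inner_self_eq_norm_sq (𝕜 := ℂ), ← adjoint_inner_left,
      hV]
  have h1 := abs_re_inner_cfc_sub_le hε hf hq hx hσ (V u)
  have h2 := abs_re_inner_cfc_sub_le hε hf hq (hx.adjoint_conj V)
    (spectrum_compression_subset hV hx hσ) u
  rw [inner_aeval_compression hV x q u hmem, ← hnorm] at h2
  rw [abs_le] at h1 h2 ⊢
  constructor <;> linarith [h1.1, h1.2, h2.1, h2.2]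

/-- If the convexity inequality holds for all self-adjoint operators on `F` and `V : F → E` is an
isometry whose range contains enough powers of `x`, `y` and their convex combination applied to
`V u`, then the convexity inequality for `x`, `y` holds at `V u` up to a small error. -/
theorem re_inner_cfc_convexComb_le {f : ℝ → ℝ} {α β ε t : ℝ} (hε : 0 ≤ ε)
    (hf : ContinuousOn f (Set.Icc α β)) (ht : t ∈ Set.Icc (0 : ℝ) 1)
    (hconv : ∀ a b : F →L[ℂ] F, IsSelfAdjoint a → IsSelfAdjoint b →
      spectrum ℝ a ⊆ Set.Icc α β → spectrum ℝ b ⊆ Set.Icc α β →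
        cfc f (t • a + (1 - t) • b) ≤ t • cfc f a + (1 - t) • cfc f b) {q : Polynomial ℝ}
    (hq : ∀ r ∈ Set.Icc α β, |q.eval r - f r| ≤ ε) {V : F →L[ℂ] E}
    (hV : ∀ v, adjoint V (V v) = v) {x y : E →L[ℂ] E} (hx : IsSelfAdjoint x)
    (hy : IsSelfAdjoint y) (hσx : spectrum ℝ x ⊆ Set.Icc α β)
    (hσy : spectrum ℝ y ⊆ Set.Icc α β) {u : F}
    (hmx : ∀ k ≤ q.natDegree, (x ^ k) (V u) ∈ Set.range V)
    (hmy : ∀ k ≤ q.natDegree, (y ^ k) (V u) ∈ Set.range V)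
    (hmz : ∀ k ≤ q.natDegree, ((t • x + (1 - t) • y) ^ k) (V u) ∈ Set.range V) :
    (inner ℂ (cfc f (t • x + (1 - t) • y) (V u)) (V u)).re ≤
      (inner ℂ ((t • cfc f x + (1 - t) • cfc f y) (V u)) (V u)).re + 4 * (ε * ‖V u‖ ^ 2) := by
  have hz : IsSelfAdjoint (t • x + (1 - t) • y) :=
    ((IsSelfAdjoint.all t).smul hx).add ((IsSelfAdjoint.all (1 - t)).smul hy)
  have hσz := spectrum_convexComb_subset hx hy hσx hσy ht
  have hcomb : adjoint V ∘L (t • x + (1 - t) • y) ∘L V =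
      t • (adjoint V ∘L x ∘L V) + (1 - t) • (adjoint V ∘L y ∘L V) := by
    ext w
    simp
  have key := hconv _ _ (hx.adjoint_conj V) (hy.adjoint_conj V)
    (spectrum_compression_subset hV hx hσx) (spectrum_compression_subset hV hy hσy)
  rw [← hcomb] at key
  have key' := re_inner_le_of_le key u
  have hX := abs_le.mp (abs_re_inner_cfc_compression_sub_le hε hf hq hV hx hσx hmx)
  have hY := abs_le.mp (abs_re_inner_cfc_compression_sub_le hε hf hq hV hy hσy hmy)
  have hZ := abs_le.mp (abs_re_inner_cfc_compression_sub_le hε hf hq hV hz hσz hmz)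
  rw [re_inner_convexComb] at key' ⊢
  have h1 := mul_le_mul_of_nonneg_left hX.2 ht.1
  have h2 := mul_le_mul_of_nonneg_left hY.2 (sub_nonneg.mpr ht.2)
  linarith [hZ.1]

end CFC

end Operators

/-- Let `f` be continuous on an interval `I ⊆ ℝ` and let `H` be an infinite-dimensional complex
Hilbert space.  If the pinching inequality `p f(p x p + s(1 − p)) p ≤ p f(x) p` holds for every
orthogonal projection `p` on `H`, every bounded self-adjoint `x` on `H` with spectrum in `I`
and every `s ∈ I`, then `f` is operator convex on `I`. -/
theorem operatorConvexOn_of_pinching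
    (f : ℝ → ℝ) (I : Set ℝ) (hI : I.OrdConnected) (hf : ContinuousOn f I)
    (H : Type) [NormedAddCommGroup H] [InnerProductSpace ℂ H] [CompleteSpace H]
    (hdim : ¬ FiniteDimensional ℂ H)
    (hyp : ∀ p x : H →L[ℂ] H, IsSelfAdjoint p → p * p = p → IsSelfAdjoint x →
      spectrum ℝ x ⊆ I → ∀ s ∈ I,
        p * cfc f (p * x * p + s • (1 - p)) * p ≤ p * cfc f x * p) :
    OperatorConvexOn f I := by
  intro E _ _ _ hE x y hx hy hσx hσy t ht
  have : Nontrivial E := by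
    by_contra h
    rw [not_nontrivial_iff_subsingleton] at h
    exact hE inferInstance
  have hne : (spectrum ℝ x ∪ spectrum ℝ y).Nonempty :=
    (ContinuousFunctionalCalculus.spectrum_nonempty x hx).mono Set.subset_union_left
  have hcomp : IsCompact (spectrum ℝ x ∪ spectrum ℝ y) :=
    (spectrum.isCompact x).union (spectrum.isCompact y)
  obtain ⟨α, hαmem, hα⟩ := hcomp.exists_isLeast hne
  obtain ⟨β, hβmem, hβ⟩ := hcomp.exists_isGreatest hne
  have hsub : spectrum ℝ x ∪ spectrum ℝ y ⊆ Set.Icc α β := fun r hr => ⟨hα hr, hβ hr⟩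
  have hαI : α ∈ I := Set.union_subset hσx hσy hαmem
  have hIcc : Set.Icc α β ⊆ I := hI.out hαI (Set.union_subset hσx hσy hβmem)
  have hσx' : spectrum ℝ x ⊆ Set.Icc α β := Set.subset_union_left.trans hsub
  have hσy' : spectrum ℝ y ⊆ Set.Icc α β := Set.subset_union_right.trans hsub
  have hf' := hf.mono hIcc
  set z := t • x + (1 - t) • y
  refine le_of_re_inner_le (cfc_predicate f z) (((IsSelfAdjoint.all t).smul
    (cfc_predicate f x)).add ((IsSelfAdjoint.all (1 - t)).smul (cfc_predicate f y)))
    fun v => ?_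
  refine le_of_forall_pos_le_add fun δ hδ => ?_
  obtain ⟨ε, hε, hεδ⟩ : ∃ ε : ℝ, 0 < ε ∧ 4 * (ε * ‖v‖ ^ 2) ≤ δ := by
    refine ⟨δ / (4 * (‖v‖ ^ 2 + 1)), by positivity, ?_⟩
    rw [div_mul_eq_mul_div, ← mul_div_assoc, div_le_iff₀ (by positivity)]
    nlinarith
  obtain ⟨q, hq⟩ := exists_polynomial_near_of_continuousOn α β f hf' ε hε
  replace hq : ∀ r ∈ Set.Icc α β, |q.eval r - f r| ≤ ε := fun r hr => (hq r hr).le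
  let S : Set E := (fun k => (x ^ k) v) '' Set.Iic q.natDegree ∪
    (fun k => (y ^ k) v) '' Set.Iic q.natDegree ∪ (fun k => (z ^ k) v) '' Set.Iic q.natDegree
  have hS : S.Finite := (((Set.finite_Iic _).image _).union ((Set.finite_Iic _).image _)).union
    ((Set.finite_Iic _).image _)
  let G : Submodule ℂ E := Submodule.span ℂ S
  have : FiniteDimensional ℂ G := FiniteDimensional.span_of_finite ℂ hS
  obtain ⟨J₁, J₂, h11, h22, h12, h21⟩ := exists_orthogonal_isometries (E := H) (F := G) hdim
  let V : G →L[ℂ] E := G.subtypeL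
  have hV (w : G) : ContinuousLinearMap.adjoint V (V w) = w :=
    ext_inner_left ℂ fun w' => by rw [ContinuousLinearMap.adjoint_inner_right]; rfl
  have hmem {w : E} (hw : w ∈ S) : w ∈ Set.range V := ⟨⟨w, Submodule.subset_span hw⟩, rfl⟩
  have hmx : ∀ k ≤ q.natDegree, (x ^ k) v ∈ Set.range V := fun k hk =>
    hmem (.inl (.inl ⟨k, hk, rfl⟩))
  have hmy : ∀ k ≤ q.natDegree, (y ^ k) v ∈ Set.range V := fun k hk =>
    hmem (.inl (.inr ⟨k, hk, rfl⟩))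
  have hmz : ∀ k ≤ q.natDegree, (z ^ k) v ∈ Set.range V := fun k hk =>
    hmem (.inr ⟨k, hk, rfl⟩)
  obtain ⟨u, hu⟩ : v ∈ Set.range V := by simpa using hmx 0 (Nat.zero_le _)
  rw [← hu] at hmx hmy hmz hεδ ⊢
  refine (re_inner_cfc_convexComb_le hε.le hf' ht (fun a b ha hb hσa hσb =>
    cfc_convexComb_le_of_pinching (hα hβmem) hf' (fun p x hp hpp hx hσ =>
      hyp p x hp hpp hx (hσ.trans hIcc) α hαI) h11 h22 h12 h21 ha hb hσa hσb ht)
    hq hV hx hy hσx' hσy' hmx hmy hmz).trans ?_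
  gcongr
end

section
/- Let f be a continuous convex real function on an interval I ⊆ ℝ and let m, n be natural numbers. Then Tr(f(Σ_{i=1}^n a_i* x_i a_i)) ≤ Tr(Σ_{i=1}^n a_i* f(x_i) a_i) for every n-tuple (x_1, …, x_n) of self-adjoint m×m complex matrices with spectra contained in I and every n-tuple (a_1, …, a_n) of m×m complex matrices with Σ_{k=1}^n a_k* a_k = 1. -/
open scoped ComplexOrder

/-- Diagonal entries of `c* g(x) c` as weighted sums of the values of `g` at the eigenvalues
of `x`. -/
theorem Matrix.IsHermitian.conj_cfc_apply_self {ι : Type*} [Fintype ι] [DecidableEq ι]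
    {x : Matrix ι ι ℂ} (hx : x.IsHermitian) (g : ℝ → ℝ) (c : Matrix ι ι ℂ) (j : ι) :
    (star c * cfc g x * c) j j =
      ((∑ k, ‖(star (hx.eigenvectorUnitary : Matrix ι ι ℂ) * c) k j‖ ^ 2 *
        g (hx.eigenvalues k) : ℝ) : ℂ) := by
  rw [hx.cfc_eq g, Matrix.IsHermitian.cfc, Unitary.conjStarAlgAut_apply]
  set d := star (hx.eigenvectorUnitary : Matrix ι ι ℂ) * c with hd
  have h : star d = star c * (hx.eigenvectorUnitary : Matrix ι ι ℂ) := by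
    rw [hd, star_mul, star_star]
  rw [← mul_assoc, ← mul_assoc, ← h, mul_assoc _ _ c, ← hd, Matrix.mul_apply]
  push_cast
  refine Finset.sum_congr rfl fun k _ => ?_
  rw [Matrix.mul_diagonal, Matrix.star_apply, ← Complex.conj_mul']
  simp only [Function.comp_apply, RCLike.star_def, Complex.coe_algebraMap]
  ring

/-- **Jensen's trace inequality (Theorem 2.4, direct part).**  Let `f` be a continuous convex
function on an interval `I ⊆ ℝ` and let `m, n` be natural numbers.  Then
`Tr(f(∑ aᵢ* xᵢ aᵢ)) ≤ Tr(∑ aᵢ* f(xᵢ) aᵢ)` for every `n`-tuple `(x₁, …, xₙ)` of self-adjoint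
`m × m` complex matrices with spectra in `I` and every `n`-tuple `(a₁, …, aₙ)` of `m × m`
complex matrices with `∑ aₖ* aₖ = 1`; here `f(x)` is given by the functional calculus. -/
theorem jensen_trace_inequality
    (f : ℝ → ℝ) (I : Set ℝ) (hI : I.OrdConnected) (hf : ContinuousOn f I)
    (hconv : ConvexOn ℝ I f) (m n : ℕ)
    (x a : Fin n → Matrix (Fin m) (Fin m) ℂ)
    (hx : ∀ i, (x i).IsHermitian) (hxI : ∀ i, spectrum ℝ (x i) ⊆ I)
    (ha : ∑ k, star (a k) * a k = 1) :
    (cfc f (∑ i, star (a i) * x i * a i)).trace ≤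
      (∑ i, star (a i) * cfc f (x i) * a i).trace := by
  have hy : (∑ i, star (a i) * x i * a i).IsHermitian := by
    refine isSelfAdjoint_sum _ fun i _ => ?_
    simpa using (hx i).isSelfAdjoint.conjugate' (a i)
  set y := ∑ i, star (a i) * x i * a i with hydef
  set U : Matrix (Fin m) (Fin m) ℂ := (hy.eigenvectorUnitary : Matrix (Fin m) (Fin m) ℂ) with hU
  have hUU : star U * U = 1 := Unitary.coe_star_mul_self hy.eigenvectorUnitary
  have hUU' : U * star U = 1 := Unitary.coe_mul_star_self hy.eigenvectorUnitary
  let w (j : Fin m) (p : Fin n × Fin m) : ℝ :=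
    ‖(star ((hx p.1).eigenvectorUnitary : Matrix (Fin m) (Fin m) ℂ) * (a p.1 * U)) p.2 j‖ ^ 2
  let μ (p : Fin n × Fin m) : ℝ := (hx p.1).eigenvalues p.2
  have key (g : ℝ → ℝ) (j : Fin m) :
      (star U * (∑ i, star (a i) * cfc g (x i) * a i) * U) j j =
        ((∑ p, w j p * g (μ p) : ℝ) : ℂ) := by
    rw [Finset.mul_sum, Finset.sum_mul, Matrix.sum_apply, Fintype.sum_prod_type, Complex.ofReal_sum]
    refine Finset.sum_congr rfl fun i _ => ?_
    rw [← (hx i).conj_cfc_apply_self g (a i * U) j, star_mul]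
    simp only [mul_assoc]
  have keyy (g : ℝ → ℝ) (j : Fin m) :
      (star U * cfc g y * U) j j = (g (hy.eigenvalues j) : ℂ) := by
    rw [hy.conj_cfc_apply_self g U j, ← hU, hUU, Finset.sum_eq_single j] <;>
      simp +contextual
  have trace_conj (z : Matrix (Fin m) (Fin m) ℂ) : z.trace = ∑ j, (star U * z * U) j j := by
    change _ = (star U * z * U).trace
    rw [Matrix.trace_mul_comm, ← mul_assoc, hUU', one_mul]
  have weights (j : Fin m) : ∑ p, w j p = 1 := by
    have h := key (fun _ => 1) j
    have h1 (i : Fin n) : cfc (fun _ : ℝ => (1 : ℝ)) (x i) = 1 :=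
      cfc_const_one ℝ (x i) (hx i).isSelfAdjoint
    simp only [h1, mul_one, ha, hUU, Matrix.one_apply_eq] at h
    exact_mod_cast h.symm
  have barycenter (j : Fin m) : ∑ p, w j p * μ p = hy.eigenvalues j := by
    have h := key (fun t => t) j
    have h1 (i : Fin n) : cfc (fun t : ℝ => t) (x i) = x i :=
      cfc_id' ℝ (x i) (hx i).isSelfAdjoint
    have h2 := keyy (fun t => t) j
    rw [cfc_id' ℝ y hy.isSelfAdjoint] at h2
    simp only [h1, ← hydef] at h
    exact_mod_cast h.symm.trans h2
  rw [trace_conj, trace_conj (∑ i, _)]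
  refine Finset.sum_le_sum fun j _ => ?_
  rw [key, keyy, Complex.real_le_real, ← barycenter]
  exact hconv.map_sum_le (fun p _ => sq_nonneg _) (weights j)
    fun p _ => hxI p.1 ((hx p.1).eigenvalues_mem_spectrum_real p.2)
end

section
/- Let f be a continuous real function on an interval I ⊆ ℝ and let m, n be natural numbers with n > 1. Suppose that Tr(f(Σ_{i=1}^n a_i* x_i a_i)) ≤ Tr(Σ_{i=1}^n a_i* f(x_i) a_i) for every n-tuple (x_1, …, x_n) of self-adjoint m×m complex matrices with spectra contained in I and every n-tuple (a_1, …, a_n) of m×m complex matrices with Σ_{k=1}^n a_k* a_k = 1. Then f is convex on I. -/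
open scoped ComplexOrder

/-- Weights supported on two distinct indices reduce a finite weighted sum to two terms. -/
theorem sum_two_point_weights {ι : Type*} [Fintype ι] [DecidableEq ι] {j k : ι} (hjk : j ≠ k)
    (s t x y : ℝ) (g : ℝ → ℝ) :
    ∑ i, (if i = j then s else if i = k then t else 0) * g (if i = j then x else y) =
      s * g x + t * g y := by
  have h : ∀ i, (if i = j then s else if i = k then t else 0) * g (if i = j then x else y) =
      (if i = j then s * g x else 0) + (if i = k then t * g y else 0) := by
    intro i
    by_cases hj : i = j
    · simp [hj, hjk]
    · by_cases hk : i = k <;> simp [hj, hk, hjk.symm]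
  simp [h, Finset.sum_add_distrib]

/-- **Jensen's trace inequality (Theorem 2.4, converse part).**  Let `f` be continuous on an
interval `I ⊆ ℝ` and let `m ≥ 1`, `n > 1` be natural numbers.  If
`Tr(f(∑ aᵢ* xᵢ aᵢ)) ≤ Tr(∑ aᵢ* f(xᵢ) aᵢ)` for every `n`-tuple `(x₁, …, xₙ)` of self-adjoint
`m × m` complex matrices with spectra in `I` and every `n`-tuple `(a₁, …, aₙ)` of `m × m`
complex matrices with `∑ aₖ* aₖ = 1`, then `f` is convex on `I`. -/
theorem convexOn_of_jensen_trace_inequality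
    (f : ℝ → ℝ) (I : Set ℝ) (hI : I.OrdConnected) (hf : ContinuousOn f I)
    (m n : ℕ) (hm : 0 < m) (hn : 1 < n)
    (hyp : ∀ x a : Fin n → Matrix (Fin m) (Fin m) ℂ,
      (∀ i, (x i).IsHermitian) → (∀ i, spectrum ℝ (x i) ⊆ I) →
        ∑ k, star (a k) * a k = 1 →
          (cfc f (∑ i, star (a i) * x i * a i)).trace ≤
            (∑ i, star (a i) * cfc f (x i) * a i).trace) :
    ConvexOn ℝ I f := by
  refine ⟨hI.convex, ?_⟩
  intro x hx y hy s t hs ht hst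
  have : NeZero m := ⟨hm.ne'⟩
  let j : Fin n := ⟨0, by omega⟩
  let k : Fin n := ⟨1, hn⟩
  have hjk : j ≠ k := by simp [j, k]
  let φ := algebraMap ℝ (Matrix (Fin m) (Fin m) ℂ)
  let p : Fin n → ℝ := fun i => if i = j then s else if i = k then t else 0
  let ξ : Fin n → ℝ := fun i => if i = j then x else y
  have hsum (g : ℝ → ℝ) : ∑ i, p i * g (ξ i) = s * g x + t * g y :=
    sum_two_point_weights hjk s t x y g
  have hp (i : Fin n) : 0 ≤ p i := by
    dsimp only [p]
    split_ifs <;> simp [hs, ht]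
  have hstar (r : ℝ) : star (φ r) = φ r := (IsSelfAdjoint.algebraMap _ (.all r)).star_eq
  have hconj (i : Fin n) (r : ℝ) :
      star (φ (√(p i))) * φ r * φ (√(p i)) = φ (p i * r) := by
    rw [hstar, ← map_mul, ← map_mul, mul_right_comm, Real.mul_self_sqrt (hp i)]
  have hcfc (r : ℝ) : cfc f (φ r) = φ (f r) := cfc_algebraMap r f
  have htrace (r : ℝ) : (φ r).trace = ((m * r : ℝ) : ℂ) := by
    simp [φ, Matrix.trace, Matrix.algebraMap_matrix_apply]
  have key := hyp (fun i => φ (ξ i)) (fun i => φ (√(p i))) (fun i => hstar _)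
    (fun i => by
      rw [spectrum.scalar_eq, Set.singleton_subset_iff]
      dsimp only [ξ]
      split_ifs <;> assumption)
    (by
      have h (i : Fin n) : star (φ (√(p i))) * φ (√(p i)) = φ (p i) := by
        simpa using hconj i 1
      have hone : ∑ i, p i = 1 := by simpa [hst] using hsum fun _ => 1
      simp only [h, ← map_sum, hone, map_one])
  simp only [hcfc, hconj, ← map_sum, htrace, hsum f] at key
  rw [show ∑ i, p i * ξ i = s * x + t * y from hsum id,
    Complex.real_le_real] at key
  exact le_of_mul_le_mul_left key (by exact_mod_cast hm)
end
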